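/- arXiv:math/9412203 — 4 statements merged into one kernel-verified Lean document; each statement's English description precedes it below -/
import Mathlib

section
/- Let H be a subgroup of F, let T be a Schreier transversal for H regarded as a tree, and let (T_i) be a sequence of finite subgraphs of T with liminf T_i = T. For each i let T_{i,1}, …, T_{i,α(T_i)} be the connected components of T_i. Then the limit lim_{i→∞} ( α(T_i) + (n−1)·|V(T_i)| − (1/2)·Σ_{j=1}^{α(T_i)} |∂_out T_{i,j}| ) exists in [0, ∞] and equals rank(H), where ∂_out T_{i,j} is the outer boundary in T of the component T_{i,j}. -/
open FreeGroup

/-- A Schreier transversal for a subgroup `H` of the free group on `Fin n`: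
a set of representatives, exactly one for each right coset `Hg`, closed under
taking initial segments (prefixes) of reduced words. -/
def IsSchreierTransversal {n : ℕ} (H : Subgroup (FreeGroup (Fin n)))
    (T : Set (FreeGroup (Fin n))) : Prop :=
  (∀ g : FreeGroup (Fin n), ∃! t, t ∈ T ∧ g * t⁻¹ ∈ H) ∧
  (∀ t ∈ T, ∀ k : ℕ, FreeGroup.mk ((FreeGroup.toWord t).take k) ∈ T)

/-- `B` is a free basis of the subgroup `H`: `B ⊆ H` and the induced homomorphism
from the free group on `B` to `H` is an isomorphism. -/
def IsFreeBasis {G : Type*} [Group G] (H : Subgroup G) (B : Set G) : Prop :=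
  ∃ hB : ∀ b ∈ B, b ∈ H,
    Function.Bijective (FreeGroup.lift (fun b : B => (⟨(b : G), hB b b.2⟩ : H)))

open scoped Classical in
/-- The rank value determined by a free basis `B`, as an extended real:
the cardinality of `B`, or `∞` if `B` is infinite. -/
noncomputable def rankEReal {G : Type*} (B : Set G) : EReal :=
  if h : B.Finite then ((h.toFinset.card : ℝ) : EReal) else ⊤

/-- The tree structure on a Schreier transversal `T`: two elements are adjacent
exactly when the reduced word of one is a one-letter extension of that of the other. -/
def transGraph {n : ℕ} (T : Set (FreeGroup (Fin n))) : SimpleGraph T :=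
  SimpleGraph.fromRel (fun t t' => ∃ a : Fin n × Bool,
    FreeGroup.toWord (t' : FreeGroup (Fin n)) = FreeGroup.toWord (t : FreeGroup (Fin n)) ++ [a])

/-- The vertex set (in the ambient vertex type) of the connected component `c`
of the subgraph `S`. -/
def compVerts {V : Type*} {G : SimpleGraph V} (S : G.Subgraph)
    (c : S.coe.ConnectedComponent) : Set V :=
  {v | ∃ hv : v ∈ S.verts, S.coe.connectedComponentMk ⟨v, hv⟩ = c}

/-- The outer boundary, in the ambient graph `G`, of the connected component `c` of
the subgraph `S`: the vertices outside the component which are adjacent to it in `G`. -/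
def outerBoundary {V : Type*} {G : SimpleGraph V} (S : G.Subgraph)
    (c : S.coe.ConnectedComponent) : Set V :=
  {v | v ∉ compVerts S c ∧ ∃ u ∈ compVerts S c, G.Adj v u}

/-- `α(S) + (n−1)·|V(S)| − (1/2)·Σ_j |∂_out S_j|`, where the sum runs over the
connected components `S_j` of `S` (encoded as the number of pairs `(v, c)` with
`v` in the outer boundary of the component `c`). -/
noncomputable def subgraphVal (n : ℕ) {V : Type*} {G : SimpleGraph V} (S : G.Subgraph) : ℚ :=
  (Nat.card S.coe.ConnectedComponent : ℚ) + ((n : ℚ) - 1) * (S.verts.ncard : ℚ) -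
    (Nat.card {p : V × S.coe.ConnectedComponent // p.1 ∈ outerBoundary S p.2} : ℚ) / 2

section GraphPart

open SimpleGraph

theorem gs_forest_count {V : Type*} [Finite V] (G : SimpleGraph V) (hG : G.IsAcyclic) :
    Nat.card G.Dart + 2 * Nat.card G.ConnectedComponent = 2 * Nat.card V := by
  classical
  have := Fintype.ofFinite V
  have hV : Nat.card V = ∑ c : G.ConnectedComponent, Nat.card c.supp := by
    rw [Nat.card_congr (Equiv.sigmaFiberEquiv G.connectedComponentMk).symm, Nat.card_sigma]
    rfl
  have hD : Nat.card G.Dart =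
      ∑ c : G.ConnectedComponent, Nat.card c.toSimpleGraph.Dart := by
    rw [Nat.card_congr
      (Equiv.sigmaFiberEquiv (fun d : G.Dart => G.connectedComponentMk d.fst)).symm,
      Nat.card_sigma]
    refine Finset.sum_congr rfl fun c _ => ?_
    refine Nat.card_congr (Equiv.symm (Equiv.ofBijective
      (fun d : c.toSimpleGraph.Dart =>
        (⟨⟨(d.fst.1, d.snd.1), d.adj⟩, d.fst.2⟩ :
          {d : G.Dart // G.connectedComponentMk d.fst = c})) ⟨?_, ?_⟩))
    · rintro ⟨⟨⟨a, ha⟩, ⟨b, hb⟩⟩, h⟩ ⟨⟨⟨a', ha'⟩, ⟨b', hb'⟩⟩, h'⟩ hh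
      simp at hh
      obtain ⟨rfl, rfl⟩ := hh
      rfl
    · rintro ⟨⟨⟨a, b⟩, h⟩, hd⟩
      have hb : G.connectedComponentMk b = c := by
        rw [← hd]
        exact (ConnectedComponent.connectedComponentMk_eq_of_adj h).symm
      exact ⟨⟨(⟨a, hd⟩, ⟨b, hb⟩), h⟩, rfl⟩
  have hc : ∀ c : G.ConnectedComponent,
      Nat.card c.toSimpleGraph.Dart + 2 = 2 * Nat.card c.supp := by
    intro c
    have h1 := (hG.isTree_connectedComponent c).card_edgeFinset
    have h2 := c.toSimpleGraph.dart_card_eq_twice_card_edges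
    rw [Nat.card_eq_fintype_card, h2, Nat.card_eq_fintype_card]
    have h3 : Fintype.card c = Fintype.card c.supp := Fintype.card_congr (Equiv.refl _)
    omega
  have hs := Finset.sum_congr rfl (fun c (_ : c ∈ (Finset.univ : Finset G.ConnectedComponent)) => hc c)
  rw [Finset.sum_add_distrib, ← hD, ← Finset.mul_sum, ← hV] at hs
  rw [← hs]
  simp [mul_comm]

theorem gs_bridge {V : Type*} {G G' : SimpleGraph V} (hG : G.IsAcyclic) (hle : G' ≤ G)
    {u v : V} (h : G.Adj u v) (hr : G'.Reachable u v) : G'.Adj u v := by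
  by_contra hn
  refine (isAcyclic_iff_forall_adj_isBridge.1 hG h) (hr.mono ?_)
  intro a b hab
  rw [deleteEdges_adj]
  refine ⟨hle hab, fun he => hn ?_⟩
  rw [Set.mem_singleton_iff] at he
  rw [← mem_edgeSet, ← he]
  exact hab

theorem gs_reach {V : Type*} {G : SimpleGraph V} (S : G.Subgraph) {u v : S.verts}
    (h : S.coe.Reachable u v) : S.spanningCoe.Reachable u.1 v.1 :=
  h.map ⟨Subtype.val, fun h => h⟩

theorem gs_outer {V : Type*} {G : SimpleGraph V} (hG : G.IsAcyclic) (S : G.Subgraph) :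
    Nat.card {p : V × V // (p.1 ∈ S.verts ∧ G.Adj p.1 p.2) ∧ ¬ S.Adj p.1 p.2} =
    Nat.card {p : V × S.coe.ConnectedComponent // p.1 ∈ outerBoundary S p.2} := by
  refine Nat.card_congr (Equiv.ofBijective
    (fun p => ⟨(p.1.2, S.coe.connectedComponentMk ⟨p.1.1, p.2.1.1⟩), ?_⟩) ⟨?_, ?_⟩)
  · obtain ⟨⟨u, v⟩, ⟨hu, hadj⟩, hn⟩ := p
    refine ⟨?_, u, ⟨hu, rfl⟩, hadj.symm⟩
    rintro ⟨hv, he⟩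
    have := gs_reach S (ConnectedComponent.exact he)
    exact hn (gs_bridge hG S.spanningCoe_le hadj this.symm)
  · rintro ⟨⟨u, v⟩, ⟨hu, hadj⟩, hn⟩ ⟨⟨u', v'⟩, ⟨hu', hadj'⟩, hn'⟩ h
    simp only [Subtype.mk.injEq, Prod.mk.injEq] at h
    obtain ⟨rfl, he⟩ := h
    dsimp only at hadj hadj' hn hn' hu hu'
    have hr := gs_reach S (ConnectedComponent.exact he)
    have hne : u' ≠ v := hadj'.ne
    have hG'' : S.spanningCoe ⊔ edge u' v ≤ G := by
      refine sup_le S.spanningCoe_le ?_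
      rw [edge_le_iff]
      exact Or.inr hadj'
    have hr2 : (S.spanningCoe ⊔ edge u' v).Reachable u v := by
      refine (hr.mono le_sup_left).trans (Adj.reachable ?_)
      rw [sup_adj, edge_adj]
      exact Or.inr ⟨Or.inl ⟨rfl, rfl⟩, hne⟩
    have := gs_bridge hG hG'' hadj hr2
    rw [sup_adj, edge_adj] at this
    have huv := hadj.ne
    have : u = u' := by
      rcases this with h | ⟨⟨h, _⟩ | ⟨h, _⟩, _⟩
      · exact absurd h hn
      · exact h
      · exact absurd h huv
    subst this
    rfl
  · rintro ⟨⟨v, c⟩, hv, u, ⟨hu, hc⟩, hadj⟩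
    dsimp only at hc hv hadj
    subst hc
    refine ⟨⟨(u, v), ⟨hu, hadj.symm⟩, fun h => hv ?_⟩, rfl⟩
    refine ⟨S.edge_vert h.symm, ?_⟩
    exact (ConnectedComponent.connectedComponentMk_eq_of_adj (G := S.coe)
      (v := ⟨u, hu⟩) (w := ⟨v, S.edge_vert h.symm⟩) h).symm

theorem gs_inner {V : Type*} {G : SimpleGraph V} (S : G.Subgraph) :
    Nat.card {p : V × V // (p.1 ∈ S.verts ∧ G.Adj p.1 p.2) ∧ S.Adj p.1 p.2} =
    Nat.card S.coe.Dart := by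
  refine Nat.card_congr
    { toFun := fun p => ⟨(⟨p.1.1, p.2.1.1⟩, ⟨p.1.2, S.edge_vert p.2.2.symm⟩), p.2.2⟩
      invFun := fun d => ⟨(d.fst.1, d.snd.1), ⟨d.fst.2, S.adj_sub d.adj⟩, d.adj⟩
      left_inv := fun p => rfl
      right_inv := fun d => rfl }

theorem gs_dartcount {V : Type*} {G : SimpleGraph V} (hG : G.IsAcyclic) (S : G.Subgraph)
    (hS : S.verts.Finite) (hfin : {p : V × V | p.1 ∈ S.verts ∧ G.Adj p.1 p.2}.Finite) :
    Nat.card {p : V × V // p.1 ∈ S.verts ∧ G.Adj p.1 p.2} +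
      2 * Nat.card S.coe.ConnectedComponent = 2 * S.verts.ncard +
    Nat.card {p : V × S.coe.ConnectedComponent // p.1 ∈ outerBoundary S p.2} := by
  have : Finite S.verts := hS
  have h1 := gs_forest_count S.coe (hG.subgraph S)
  rw [← gs_outer hG S]
  rw [← gs_inner S] at h1
  have h2 : Nat.card {p : V × V // p.1 ∈ S.verts ∧ G.Adj p.1 p.2} =
    Nat.card {p : V × V // (p.1 ∈ S.verts ∧ G.Adj p.1 p.2) ∧ S.Adj p.1 p.2} +
    Nat.card {p : V × V // (p.1 ∈ S.verts ∧ G.Adj p.1 p.2) ∧ ¬ S.Adj p.1 p.2} :=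
    (Set.ncard_inter_add_ncard_sdiff_eq_ncard _ {p : V × V | S.Adj p.1 p.2} hfin).symm
  have h3 : Nat.card S.verts = S.verts.ncard := rfl
  omega

end GraphPart

section TransPart

theorem gs_word {n : ℕ} (g : FreeGroup (Fin n)) (a : Fin n × Bool) :
    (g * FreeGroup.mk [a]).toWord = g.toWord ++ [a] ∨
    g.toWord = (g * FreeGroup.mk [a]).toWord ++ [(a.1, !a.2)] := by
  have hred : FreeGroup.IsReduced g.toWord := FreeGroup.isReduced_toWord
  have hmul : g * FreeGroup.mk [a] = FreeGroup.mk (g.toWord ++ [a]) := by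
    rw [← FreeGroup.mul_mk, FreeGroup.mk_toWord]
  rcases List.eq_nil_or_concat g.toWord with h | ⟨L, b, h⟩
  · left
    rw [hmul, h]; simp
  · rw [List.concat_eq_append] at h
    by_cases hb : b = (a.1, !a.2)
    · right
      have h2 : g * FreeGroup.mk [a] = FreeGroup.mk L := by
        rw [hmul, h, hb]
        apply Quot.sound
        have := FreeGroup.Red.Step.not (L₁ := L) (L₂ := []) (x := a.1) (b := !a.2)
        simpa using this
      rw [h2, FreeGroup.toWord_mk, h, hb]
      rw [FreeGroup.IsReduced.reduce_eq]
      rw [h] at hred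
      exact hred.infix (List.prefix_append _ _).isInfix
    · left
      rw [hmul, FreeGroup.toWord_mk]
      apply FreeGroup.IsReduced.reduce_eq
      rw [h] at hred ⊢
      unfold FreeGroup.IsReduced at hred ⊢
      rw [List.isChain_append]
      refine ⟨hred, by simp, ?_⟩
      intro x hx y hy
      simp at hx hy
      subst hx hy
      rcases b with ⟨b1, b2⟩
      rcases a with ⟨a1, a2⟩
      simp at hb ⊢
      intro h
      cases a2 <;> cases b2 <;> simp_all

theorem gs_adj {n : ℕ} (T : Set (FreeGroup (Fin n))) (t t' : T) :
    (transGraph T).Adj t t' ↔ ∃ a : Fin n × Bool,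
      (t' : FreeGroup (Fin n)) = (t : FreeGroup (Fin n)) * FreeGroup.mk [a] := by
  have key : ∀ (s s' : FreeGroup (Fin n)) a, s'.toWord = s.toWord ++ [a] →
      s' = s * FreeGroup.mk [a] := by
    intro s s' a h
    rw [← FreeGroup.mk_toWord (x := s'), h, ← FreeGroup.mul_mk, FreeGroup.mk_toWord]
  unfold transGraph
  rw [SimpleGraph.fromRel_adj]
  constructor
  · rintro ⟨_, ⟨a, h⟩ | ⟨a, h⟩⟩
    · exact ⟨a, key _ _ _ h⟩
    · refine ⟨(a.1, !a.2), ?_⟩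
      rw [key _ _ _ h, mul_assoc]
      have : FreeGroup.mk [a] * FreeGroup.mk [(a.1, !a.2)] = 1 := by
        rw [mul_eq_one_iff_inv_eq]
        simp [FreeGroup.inv_mk, FreeGroup.invRev]
      rw [this, mul_one]
  · rintro ⟨a, h⟩
    rcases gs_word (t : FreeGroup (Fin n)) a with h' | h'
    · rw [← h] at h'
      refine ⟨?_, Or.inl ⟨a, h'⟩⟩
      rintro rfl
      simpa using congrArg List.length h'
    · rw [← h] at h'
      refine ⟨?_, Or.inr ⟨_, h'⟩⟩
      rintro rfl
      simpa using congrArg List.length h'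

theorem gs_acyclic {n : ℕ} (T : Set (FreeGroup (Fin n))) : (transGraph T).IsAcyclic := by
  rw [SimpleGraph.isAcyclic_iff_forall_adj_isBridge]
  -- bridge for a parent-child pair
  have main : ∀ t t' : T, (∃ a, (t' : FreeGroup (Fin n)).toWord
      = (t : FreeGroup (Fin n)).toWord ++ [a]) → (transGraph T).IsBridge s(t, t') := by
    rintro t t' ⟨a, ha⟩
    rw [SimpleGraph.isBridge_iff]
    rintro ⟨w⟩
    -- the property of having t' as a prefix
    have half : ∀ s s' : T, s(s, s') ≠ s(t, t') → (∃ b, (s' : FreeGroup (Fin n)).toWord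
        = (s : FreeGroup (Fin n)).toWord ++ [b]) →
        ((t' : FreeGroup (Fin n)).toWord <+: (s : FreeGroup (Fin n)).toWord ↔
          (t' : FreeGroup (Fin n)).toWord <+: (s' : FreeGroup (Fin n)).toWord) := by
      rintro s s' hne ⟨b, hb⟩
      constructor
      · intro h
        rw [hb]
        exact h.trans (List.prefix_append _ _)
      · intro h
        rw [hb, List.prefix_concat_iff] at h
        rcases h with h | h
        · exfalso
          rw [← hb] at h
          have h1 : t' = s' := Subtype.ext (FreeGroup.toWord_injective h)
          subst h1
          rw [ha] at hb
          have h2 : t = s := Subtype.ext (FreeGroup.toWord_injective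
            (List.append_inj_left' hb rfl))
          exact hne (by rw [h2])
        · exact h
    have inv : ∀ (s s' : T) (w : ((transGraph T).deleteEdges {s(t, t')}).Walk s s'),
        ((t' : FreeGroup (Fin n)).toWord <+: (s : FreeGroup (Fin n)).toWord ↔
          (t' : FreeGroup (Fin n)).toWord <+: (s' : FreeGroup (Fin n)).toWord) := by
      intro s s' w
      induction w with
      | nil => exact Iff.rfl
      | @cons u v x h p ih =>
        refine Iff.trans ?_ ih
        rw [SimpleGraph.deleteEdges_adj] at h
        obtain ⟨h, hne⟩ := h
        rw [Set.mem_singleton_iff] at hne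
        unfold transGraph at h
        rw [SimpleGraph.fromRel_adj] at h
        rcases h.2 with h | h
        · exact half _ _ hne h
        · exact (half _ _ (by rwa [Sym2.eq_swap]) h).symm
    have := (inv t t' w).2 List.prefix_rfl
    have := this.length_le
    rw [ha] at this
    simp at this
  intro t t' h
  unfold transGraph at h
  rw [SimpleGraph.fromRel_adj] at h
  rcases h.2 with h | h
  · exact main _ _ h
  · rw [Sym2.eq_swap]
    exact main _ _ h

/-- the missing half-edges -/
def gsD {n : ℕ} (T : Set (FreeGroup (Fin n))) : Set (T × (Fin n × Bool)) :=
  {p | (p.1 : FreeGroup (Fin n)) * FreeGroup.mk [p.2] ∉ T}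

theorem gs_letter_inj {n : ℕ} {a b : Fin n × Bool}
    (h : FreeGroup.mk [a] = FreeGroup.mk [b]) : a = b := by
  have := congrArg FreeGroup.toWord h
  simpa [FreeGroup.toWord_mk, FreeGroup.reduce_singleton] using this

theorem gs_val {n : ℕ} (T : Set (FreeGroup (Fin n))) (S : (transGraph T).Subgraph)
    (hS : S.verts.Finite) :
    subgraphVal n S = ((gsD T ∩ {p | p.1 ∈ S.verts}).ncard : ℚ) / 2 := by
  let W : Set (T × (Fin n × Bool)) := {p | p.1 ∈ S.verts}
  have hW : W = S.verts ×ˢ Set.univ := by ext; simp [W]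
  have hWfin : W.Finite := by rw [hW]; exact hS.prod Set.finite_univ
  have hWc : W.ncard = S.verts.ncard * (n * 2) := by
    rw [hW, Set.ncard_prod, Set.ncard_univ]; simp
  have hb : Nat.card {p : T × T // p.1 ∈ S.verts ∧ (transGraph T).Adj p.1 p.2} =
      (W \ gsD T).ncard := by
    symm
    refine Nat.card_congr (Equiv.ofBijective (fun p => ⟨(p.1.1, ⟨(p.1.1 : FreeGroup (Fin n)) *
      FreeGroup.mk [p.1.2], not_not.1 p.2.2⟩), p.2.1, (gs_adj T _ _).2 ⟨p.1.2, rfl⟩⟩) ⟨?_, ?_⟩)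
    · rintro ⟨⟨t, a⟩, h⟩ ⟨⟨t', a'⟩, h'⟩ he
      simp only [Subtype.mk.injEq, Prod.mk.injEq] at he
      obtain ⟨rfl, he⟩ := he
      have := gs_letter_inj (mul_left_cancel he)
      subst this
      rfl
    · rintro ⟨⟨t, t'⟩, h, hadj⟩
      obtain ⟨a, ha⟩ := (gs_adj T _ _).1 hadj
      dsimp only at ha h
      refine ⟨⟨(t, a), h, ?_⟩, ?_⟩
      · simp only [gsD, Set.mem_ofPred_eq, not_not]
        rw [← ha]; exact t'.2
      · simp only [Subtype.mk.injEq, Prod.mk.injEq, true_and]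
        exact Subtype.ext ha.symm
  have hfin : {p : T × T | p.1 ∈ S.verts ∧ (transGraph T).Adj p.1 p.2}.Finite := by
    refine (hWfin.image (fun p : T × (Fin n × Bool) =>
      ((p.1 : FreeGroup (Fin n)), (p.1 : FreeGroup (Fin n)) * FreeGroup.mk [p.2]))).preimage
      (f := fun p : T × T => ((p.1 : FreeGroup (Fin n)), (p.2 : FreeGroup (Fin n)))) ?_ |>.subset ?_
    · rintro ⟨a, b⟩ _ ⟨c, d⟩ _ h
      simp only [Prod.mk.injEq] at h
      exact Prod.ext (Subtype.ext h.1) (Subtype.ext h.2)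
    · rintro ⟨t, t'⟩ ⟨h, hadj⟩
      obtain ⟨a, ha⟩ := (gs_adj T _ _).1 hadj
      exact ⟨(t, a), h, by simp [← ha]⟩
  have h1 := gs_dartcount (gs_acyclic T) S hS hfin
  have h2 := Set.ncard_inter_add_ncard_sdiff_eq_ncard W (gsD T) hWfin
  rw [hb] at h1
  rw [hWc, Set.inter_comm] at h2
  have h1' := congrArg (Nat.cast : ℕ → ℚ) h1
  have h2' := congrArg (Nat.cast : ℕ → ℚ) h2
  push_cast at h1' h2'
  unfold subgraphVal
  change _ = ((gsD T ∩ W).ncard : ℚ) / 2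
  linarith

end TransPart

section CocyclePart

/-- data of representatives -/
structure GsRep {n : ℕ} (H : Subgroup (FreeGroup (Fin n))) (T : Set (FreeGroup (Fin n)))
    (r : FreeGroup (Fin n) → FreeGroup (Fin n)) : Prop where
  mem : ∀ g, r g ∈ T
  coset : ∀ g, g * (r g)⁻¹ ∈ H
  uniq : ∀ g t, t ∈ T → g * t⁻¹ ∈ H → t = r g

theorem gs_exists_rep {n : ℕ} {H : Subgroup (FreeGroup (Fin n))} {T : Set (FreeGroup (Fin n))}
    (hT : IsSchreierTransversal H T) : ∃ r, GsRep H T r := by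
  choose r hr using hT.1
  exact ⟨r, fun g => (hr g).1.1, fun g => (hr g).1.2, fun g t h1 h2 => (hr g).2 t ⟨h1, h2⟩⟩

variable {n : ℕ} {H : Subgroup (FreeGroup (Fin n))} {T : Set (FreeGroup (Fin n))}
  {r : FreeGroup (Fin n) → FreeGroup (Fin n)}

theorem GsRep.of_mem (hr : GsRep H T r) {t : FreeGroup (Fin n)} (ht : t ∈ T) : r t = t :=
  (hr.uniq t t ht (by simp)).symm

theorem GsRep.mul_left (hr : GsRep H T r) {h : FreeGroup (Fin n)} (hh : h ∈ H)
    (g : FreeGroup (Fin n)) : r (h * g) = r g := by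
  refine (hr.uniq _ _ (hr.mem g) ?_).symm
  rw [mul_assoc]
  exact H.mul_mem hh (hr.coset g)

theorem GsRep.rep_mul (hr : GsRep H T r) (g x : FreeGroup (Fin n)) : r (r g * x) = r (g * x) := by
  have : r g * x = (g * (r g)⁻¹)⁻¹ * (g * x) := by group
  rw [this]
  exact hr.mul_left (H.inv_mem (hr.coset g)) _

theorem gs_one_mem (hT : IsSchreierTransversal H T) : (1 : FreeGroup (Fin n)) ∈ T := by
  obtain ⟨t, ⟨ht, _⟩, _⟩ := hT.1 1
  have := hT.2 t ht 0
  simpa [FreeGroup.one_eq_mk] using this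

/-- missing positive edges -/
abbrev GsE {n : ℕ} (T : Set (FreeGroup (Fin n))) : Type :=
  {p : T × Fin n // (p.1 : FreeGroup (Fin n)) * FreeGroup.of p.2 ∉ T}

/-- right translation action on functions -/
def gsAct (G M : Type*) [Group G] [Group M] : G →* MulAut (G → M) where
  toFun g :=
    { toFun := fun f u => f (u * g)
      invFun := fun f u => f (u * g⁻¹)
      left_inv := fun f => by ext u; simp
      right_inv := fun f => by ext u; simp
      map_mul' := fun f f' => rfl }
  map_one' := by ext f u; simp
  map_mul' g g' := by ext f u; simp [mul_assoc]

open scoped Classical in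
/-- value of the cocycle on a positive letter -/
noncomputable def gsLetter (T : Set (FreeGroup (Fin n)))
    (t : FreeGroup (Fin n)) (x : Fin n) : FreeGroup (GsE T) :=
  if h : ∃ _ : t ∈ T, t * FreeGroup.of x ∉ T then
    FreeGroup.of ⟨(⟨t, h.1⟩, x), h.2⟩ else 1

/-- the homomorphism into the semidirect product -/
noncomputable def gsTheta (T : Set (FreeGroup (Fin n)))
    (r : FreeGroup (Fin n) → FreeGroup (Fin n)) :
    FreeGroup (Fin n) →* SemidirectProduct (FreeGroup (Fin n) → FreeGroup (GsE T))
      (FreeGroup (Fin n)) (gsAct (FreeGroup (Fin n)) (FreeGroup (GsE T))) :=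
  FreeGroup.lift fun x => ⟨fun u => gsLetter T (r u) x, FreeGroup.of x⟩

theorem gsTheta_right (w : FreeGroup (Fin n)) : (gsTheta T r w).right = w := by
  have : (SemidirectProduct.rightHom.comp (gsTheta T r)) = MonoidHom.id _ := by
    ext x; simp [gsTheta]
  exact DFunLike.congr_fun this w

/-- the cocycle -/
noncomputable def gsC (T : Set (FreeGroup (Fin n)))
    (r : FreeGroup (Fin n) → FreeGroup (Fin n)) (u w : FreeGroup (Fin n)) : FreeGroup (GsE T) :=
  (gsTheta T r w).left u

theorem gsC_one (u : FreeGroup (Fin n)) : gsC T r u 1 = 1 := by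
  simp [gsC]

theorem gsC_mul (u w w' : FreeGroup (Fin n)) :
    gsC T r u (w * w') = gsC T r u w * gsC T r (u * w) w' := by
  unfold gsC
  rw [_root_.map_mul, SemidirectProduct.mul_left, gsTheta_right]
  rfl

theorem gsC_inv (u w : FreeGroup (Fin n)) :
    gsC T r u w⁻¹ = (gsC T r (u * w⁻¹) w)⁻¹ := by
  rw [eq_inv_iff_mul_eq_one, ← gsC_mul, inv_mul_cancel, gsC_one]

theorem gsC_of (u : FreeGroup (Fin n)) (x : Fin n) :
    gsC T r u (FreeGroup.of x) = gsLetter T (r u) x := by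
  simp [gsC, gsTheta]

theorem gsC_left (hr : GsRep H T r) {h : FreeGroup (Fin n)} (hh : h ∈ H)
    (w : FreeGroup (Fin n)) : ∀ u, gsC T r (h * u) w = gsC T r u w := by
  induction w using FreeGroup.induction_on with
  | C1 => intro u; rw [gsC_one, gsC_one]
  | of x => intro u; rw [gsC_of, gsC_of, hr.mul_left hh]
  | inv_of x ih => intro u; rw [gsC_inv, gsC_inv, mul_assoc, ih]
  | mul a b iha ihb => intro u; rw [gsC_mul, gsC_mul, iha, mul_assoc, ihb]

theorem gsC_trivial (hr : GsRep H T r) {t : FreeGroup (Fin n)} (a : Fin n × Bool)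
    (ht : t ∈ T) (hta : t * FreeGroup.mk [a] ∈ T) : gsC T r t (FreeGroup.mk [a]) = 1 := by
  have pos : ∀ (s : FreeGroup (Fin n)) (x : Fin n), s ∈ T → s * FreeGroup.of x ∈ T →
      gsC T r s (FreeGroup.of x) = 1 := by
    intro s x hs hsx
    rw [gsC_of, hr.of_mem hs, gsLetter, dif_neg]
    rintro ⟨_, h⟩
    exact h hsx
  obtain ⟨x, b⟩ := a
  cases b
  · have hx : FreeGroup.mk [(x, false)] = (FreeGroup.of x)⁻¹ := by
      simp [FreeGroup.of, FreeGroup.inv_mk, FreeGroup.invRev]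
    rw [hx] at hta ⊢
    rw [gsC_inv, pos _ _ hta (by simpa using ht), inv_one]
  · exact pos t x ht hta

theorem gsC_transversal (hT : IsSchreierTransversal H T) (hr : GsRep H T r)
    {t : FreeGroup (Fin n)} (ht : t ∈ T) : gsC T r 1 t = 1 := by
  have key : ∀ k, gsC T r 1 (FreeGroup.mk (t.toWord.take k)) = 1 := by
    intro k
    induction k with
    | zero => simpa [FreeGroup.one_eq_mk] using gsC_one (T := T) (r := r) 1
    | succ k ih =>
      by_cases hk : k < t.toWord.length
      · have h1 := hT.2 t ht k
        have h2 := hT.2 t ht (k + 1)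
        rw [List.take_succ_eq_append_getElem hk, ← FreeGroup.mul_mk] at h2 ⊢
        rw [gsC_mul, ih, one_mul, one_mul]
        exact gsC_trivial hr _ h1 h2
      · rw [List.take_of_length_le (by omega)]
        rwa [List.take_of_length_le (by omega)] at ih
  have := key t.toWord.length
  rwa [List.take_length, FreeGroup.mk_toWord] at this

/-- the Schreier generator -/
def gsGen (r : FreeGroup (Fin n) → FreeGroup (Fin n)) (e : GsE T) : FreeGroup (Fin n) :=
  (e.1.1 : FreeGroup (Fin n)) * FreeGroup.of e.1.2 *
    (r ((e.1.1 : FreeGroup (Fin n)) * FreeGroup.of e.1.2))⁻¹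

theorem gsGen_mem (hr : GsRep H T r) (e : GsE T) : gsGen r e ∈ H := hr.coset _

theorem gsC_lift (hr : GsRep H T r) (w : FreeGroup (Fin n)) : ∀ u,
    FreeGroup.lift (gsGen (T := T) r) (gsC T r u w) = r u * w * (r (u * w))⁻¹ := by
  induction w using FreeGroup.induction_on with
  | C1 => intro u; simp [gsC_one]
  | of x =>
    intro u
    rw [gsC_of, gsLetter]
    split_ifs with h
    · rw [FreeGroup.lift_apply_of, gsGen]
      dsimp only
      rw [hr.rep_mul]
    · have : r u * FreeGroup.of x ∈ T := by
        by_contra h'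
        exact h ⟨hr.mem u, h'⟩
      rw [← hr.rep_mul, hr.of_mem this]
      simp
  | inv_of x ih => intro u; rw [gsC_inv, _root_.map_inv, ih]; simp [mul_assoc]
  | mul a b iha ihb => intro u; rw [gsC_mul, _root_.map_mul, iha, ihb]; simp [mul_assoc]

theorem gs_free (hT : IsSchreierTransversal H T) (hr : GsRep H T r) :
    Nonempty (FreeGroup (GsE T) ≃* H) := by
  have hone : r 1 = 1 := hr.of_mem (gs_one_mem hT)
  let φ : FreeGroup (GsE T) →* H := FreeGroup.lift fun e => ⟨gsGen r e, gsGen_mem hr e⟩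
  let ψ : H →* FreeGroup (GsE T) :=
    { toFun := fun h => gsC T r 1 h
      map_one' := gsC_one 1
      map_mul' := fun a b => by
        have := gsC_left hr a.2 (b : FreeGroup (Fin n)) 1
        rw [mul_one] at this
        rw [Subgroup.coe_mul, gsC_mul, one_mul, this] }
  have hφ : ∀ m, ((φ m : H) : FreeGroup (Fin n)) = FreeGroup.lift (gsGen r) m := by
    intro m
    have : H.subtype.comp φ = FreeGroup.lift (gsGen (T := T) r) := by
      ext e; simp [φ]
    exact DFunLike.congr_fun this m
  refine ⟨MonoidHom.toMulEquiv φ ψ ?_ ?_⟩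
  · ext e
    simp only [MonoidHom.comp_apply, MonoidHom.id_apply]
    change gsC T r 1 ((φ (FreeGroup.of e) : H) : FreeGroup (Fin n)) = FreeGroup.of e
    rw [hφ, FreeGroup.lift_apply_of, gsGen, gsC_mul, gsC_mul, one_mul, one_mul,
      gsC_transversal hT hr e.1.1.2, one_mul, gsC_of, hr.of_mem e.1.1.2, gsC_inv]
    have h1 : (e.1.1 : FreeGroup (Fin n)) * FreeGroup.of e.1.2 *
      (r ((e.1.1 : FreeGroup (Fin n)) * FreeGroup.of e.1.2))⁻¹ ∈ H := hr.coset _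
    have h2 := gsC_left hr h1 (r ((e.1.1 : FreeGroup (Fin n)) * FreeGroup.of e.1.2)) 1
    rw [mul_one] at h2
    rw [h2, gsC_transversal hT hr (hr.mem _), inv_one, mul_one, gsLetter,
      dif_pos ⟨e.1.1.2, e.2⟩]
  · ext h
    simp only [MonoidHom.comp_apply, MonoidHom.id_apply]
    rw [hφ]
    change FreeGroup.lift (gsGen r) (gsC T r 1 h) = _
    rw [gsC_lift hr, one_mul, hone, one_mul]
    have : r (h : FreeGroup (Fin n)) = 1 := by
      have := hr.mul_left h.2 1
      rwa [mul_one, hone] at this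
    rw [this, inv_one, mul_one]

theorem gs_double (hr : GsRep H T r) : Nonempty (GsE T × Bool ≃ gsD T) := by
  have hneg : ∀ x : Fin n, FreeGroup.mk [(x, false)] = (FreeGroup.of x)⁻¹ := by
    intro x
    simp [FreeGroup.of, FreeGroup.inv_mk, FreeGroup.invRev]
  -- translating back
  have back : ∀ (t y : FreeGroup (Fin n)), t ∈ T → r (r (t * y) * y⁻¹) = t := by
    intro t y ht
    rw [hr.rep_mul, mul_assoc, mul_inv_cancel, mul_one, hr.of_mem ht]
  have flip : ∀ (t y : FreeGroup (Fin n)), t ∈ T → t * y ∉ T → r (t * y) * y⁻¹ ∉ T := by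
    intro t y ht hty hm
    apply hty
    have h1 := back t y ht
    rw [hr.of_mem hm] at h1
    have : t * y = r (t * y) := by
      conv_lhs => rw [← h1]
      simp
    rw [this]
    exact hr.mem _
  let f : GsE T × Bool → gsD T := fun e => match e with
    | (e, true) => ⟨(e.1.1, (e.1.2, true)), e.2⟩
    | (e, false) => ⟨(⟨r (e.1.1 * FreeGroup.of e.1.2), hr.mem _⟩, (e.1.2, false)), by
        have := flip _ _ e.1.1.2 e.2
        simp only [gsD, Set.mem_ofPred_eq]
        rwa [hneg]⟩
  refine ⟨Equiv.ofBijective f ⟨?_, ?_⟩⟩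
  · rintro ⟨⟨⟨⟨t, ht⟩, x⟩, he⟩, b⟩ ⟨⟨⟨⟨t', ht'⟩, x'⟩, he'⟩, b'⟩ h
    cases b <;> cases b' <;> simp only [f, Subtype.mk.injEq, Prod.mk.injEq] at h
    · obtain ⟨h, rfl, _⟩ := h
      have h1 := back t (FreeGroup.of x) ht
      have h2 := back t' (FreeGroup.of x) ht'
      rw [h] at h1
      have : t = t' := h1.symm.trans h2
      subst this
      rfl
    · exact absurd (congrArg (fun d : gsD T => d.1.2.2) h) (by simp)
    · exact absurd (congrArg (fun d : gsD T => d.1.2.2) h) (by simp)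
    · obtain ⟨rfl, rfl, _⟩ := h
      rfl
  · rintro ⟨⟨⟨t, ht⟩, ⟨x, b⟩⟩, h⟩
    cases b
    · simp only [gsD, Set.mem_ofPred_eq] at h
      rw [hneg] at h
      have h1 := flip _ _ ht h
      have h2 := back t (FreeGroup.of x)⁻¹ ht
      rw [inv_inv] at h1 h2
      refine ⟨(⟨(⟨r (t * (FreeGroup.of x)⁻¹), hr.mem _⟩, x), h1⟩, false), ?_⟩
      simp only [f, h2]
    · exact ⟨(⟨(⟨t, ht⟩, x), h⟩, true), rfl⟩

theorem gs_rank (hT : IsSchreierTransversal H T) (B : Set (FreeGroup (Fin n)))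
    (hB : IsFreeBasis H B) : Nonempty (B × Bool ≃ gsD T) := by
  obtain ⟨r, hr⟩ := gs_exists_rep hT
  obtain ⟨e⟩ := gs_free hT hr
  obtain ⟨d⟩ := gs_double hr
  obtain ⟨_, hb⟩ := hB
  have e2 := Equiv.ofFreeGroupEquiv ((MulEquiv.ofBijective _ hb).trans e.symm)
  exact ⟨(Equiv.prodCongr e2 (Equiv.refl _)).trans d⟩

end CocyclePart

/-- Generalized Schreier formula: for finite subgraphs `S i` of the Schreier
transversal tree with `liminf S i = T`, the quantity
`α(S i) + (n−1)·|V(S i)| − (1/2)·Σ_j |∂_out (S i)_j|` converges (in `[0,∞]`)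
to the rank of `H`. -/
theorem generalized_schreier_formula {n : ℕ} (hn : 1 ≤ n)
    (H : Subgroup (FreeGroup (Fin n))) (T : Set (FreeGroup (Fin n)))
    (hT : IsSchreierTransversal H T)
    (S : ℕ → (transGraph T).Subgraph)
    (hfin : ∀ i, (S i).verts.Finite)
    (hliminfV : ∀ v : T, ∃ N, ∀ j, N ≤ j → v ∈ (S j).verts)
    (hliminfE : ∀ u v : T, (transGraph T).Adj u v → ∃ N, ∀ j, N ≤ j → (S j).Adj u v)
    (B : Set (FreeGroup (Fin n))) (hB : IsFreeBasis H B) :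
    Filter.Tendsto (fun i => ((subgraphVal n (S i) : ℝ) : EReal)) Filter.atTop
      (nhds (rankEReal B)) := by
  classical
  obtain ⟨eqv⟩ := gs_rank hT B hB
  have hval : ∀ i, ((subgraphVal n (S i) : ℝ) : EReal) =
      ((((gsD T ∩ {p | p.1 ∈ (S i).verts}).ncard : ℝ) / 2 : ℝ) : EReal) := by
    intro i
    rw [gs_val T (S i) (hfin i)]
    push_cast
    rfl
  have hev : ∀ A : Set (T × (Fin n × Bool)), A.Finite → 
      ∀ᶠ i in Filter.atTop, A ⊆ {p | p.1 ∈ (S i).verts} := by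
    intro A hA
    have : ∀ᶠ i in Filter.atTop, ∀ p ∈ A, p.1 ∈ (S i).verts := by
      rw [Filter.eventually_all_finite hA]
      intro p _
      obtain ⟨N, hN⟩ := hliminfV p.1
      exact Filter.eventually_atTop.2 ⟨N, hN⟩
    exact this
  unfold rankEReal
  split_ifs with hfinB
  · have : Finite B := hfinB
    have hDfin : (gsD T).Finite := Finite.of_equiv _ eqv
    have hcard : (gsD T).ncard = 2 * hfinB.toFinset.card := by
      have h1 := Nat.card_congr eqv
      rw [Nat.card_prod] at h1
      rw [← Set.ncard_eq_toFinset_card B hfinB]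
      change Nat.card (gsD T) = 2 * Nat.card B
      rw [← h1]
      simp [mul_comm]
    refine tendsto_const_nhds.congr' ?_
    filter_upwards [hev _ hDfin] with i hi
    rw [hval, Set.inter_eq_left.2 hi, hcard]
    rw [EReal.coe_eq_coe_iff]
    push_cast
    ring
  · rw [EReal.tendsto_nhds_top_iff_real]
    intro x
    have hDinf : (gsD T).Infinite := by
      intro hD
      apply hfinB
      have : Finite (gsD T) := hD
      have : Finite (B × Bool) := Finite.of_equiv _ eqv.symm
      exact Finite.of_injective (fun b : B => (b, true)) (fun a b h => by simpa using h)
    obtain ⟨k, hk⟩ := exists_nat_gt (2 * x)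
    obtain ⟨A, hA, hAk⟩ := hDinf.exists_subset_card_eq k
    filter_upwards [hev _ A.finite_toSet] with i hi
    rw [hval, EReal.coe_lt_coe_iff]
    have hWfin : {p : T × (Fin n × Bool) | p.1 ∈ (S i).verts}.Finite := by
      have : {p : T × (Fin n × Bool) | p.1 ∈ (S i).verts} = (S i).verts ×ˢ Set.univ := by
        ext; simp
      rw [this]
      exact (hfin i).prod Set.finite_univ
    have h1 := Set.ncard_le_ncard (Set.subset_inter hA hi) (hWfin.subset Set.inter_subset_right)
    rw [Set.ncard_coe_finset, hAk] at h1
    have h2 : (k : ℝ) ≤ ((gsD T ∩ {p | p.1 ∈ (S i).verts}).ncard : ℝ) := by exact_mod_cast h1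
    linarith
end

section
/- Let H be a subgroup of F and T a Schreier transversal for H. Then the sequence of rational numbers r_T(i) = 1 + (n−1)·Γ_T(i) − γ_T(i+1)/2 is nondecreasing in i and its limit (supremum) in [0, ∞] equals rank(H); that is, rank(H) = 1 + lim_{i→∞} ( (n−1)·Γ_T(i) − γ_T(i+1)/2 ). -/
open FreeGroup

/-- `Γ_T(i)`, the number of elements of the transversal `T` of length at most `i`. -/
noncomputable def GammaT {n : ℕ} (T : Set (FreeGroup (Fin n))) (i : ℕ) : ℕ :=
  Set.ncard {t ∈ T | FreeGroup.norm t ≤ i}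

/-- `γ_T(i)`, the number of elements of the transversal `T` of length exactly `i`. -/
noncomputable def gammaT {n : ℕ} (T : Set (FreeGroup (Fin n))) (i : ℕ) : ℕ :=
  Set.ncard {t ∈ T | FreeGroup.norm t = i}

/-- `r_T(i) = 1 + (n−1)·Γ_T(i) − γ_T(i+1)/2`. -/
noncomputable def rT (n : ℕ) (T : Set (FreeGroup (Fin n))) (i : ℕ) : ℚ :=
  1 + ((n : ℚ) - 1) * (GammaT T i : ℚ) - (gammaT T (i + 1) : ℚ) / 2

namespace SchreierRank

/-- The one-letter word. -/
def g {n : ℕ} (x : Fin n × Bool) : FreeGroup (Fin n) := FreeGroup.mk [x]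

/-- The inverse letter. -/
def bar {n : ℕ} (x : Fin n × Bool) : Fin n × Bool := (x.1, !x.2)

lemma bar_bar {n : ℕ} (x : Fin n × Bool) : bar (bar x) = x := by simp [bar]

lemma g_bar {n : ℕ} (x : Fin n × Bool) : g (bar x) = (g x)⁻¹ := by
  simp [g, bar, FreeGroup.inv_mk, FreeGroup.invRev]

lemma g_true {n : ℕ} (a : Fin n) : g (a, true) = FreeGroup.of a := rfl

lemma g_false {n : ℕ} (a : Fin n) : g (a, false) = (FreeGroup.of a)⁻¹ := by
  rw [← g_true, ← g_bar]; rfl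

lemma toWord_mk_of_append {n : ℕ} {t : FreeGroup (Fin n)} {L : List (Fin n × Bool)}
    {x : Fin n × Bool} (h : t.toWord = L ++ [x]) :
    (FreeGroup.mk L).toWord = L ∧ t = FreeGroup.mk L * g x := by
  constructor
  · have : FreeGroup.IsReduced t.toWord := FreeGroup.isReduced_toWord
    rw [h] at this
    rw [FreeGroup.toWord_mk]
    exact (this.infix ⟨[], [x], by simp⟩).reduce_eq
  · rw [g, FreeGroup.mul_mk, ← h, FreeGroup.mk_toWord]

lemma step {n : ℕ} (t : FreeGroup (Fin n)) (x : Fin n × Bool) :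
    (t * g x).toWord = t.toWord ++ [x] ∨ t.toWord = (t * g x).toWord ++ [bar x] := by
  by_cases h : FreeGroup.IsReduced (t.toWord ++ [x])
  · left
    rw [← h.reduce_eq, ← FreeGroup.toWord_mk, ← FreeGroup.mul_mk, FreeGroup.mk_toWord, g]
  · right
    rcases List.eq_nil_or_concat t.toWord with h0 | ⟨L, y, hL⟩
    · rw [h0] at h; exact absurd FreeGroup.IsReduced.singleton h
    · have hr : FreeGroup.IsReduced t.toWord := FreeGroup.isReduced_toWord
      have hy : y = bar x := by
        by_contra hne
        apply h
        rw [FreeGroup.IsReduced, List.isChain_append]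
        refine ⟨hr, by simp, ?_⟩
        rw [hL]
        intro p hp q hq h1
        simp at hp hq
        subst hp hq
        by_contra h2
        apply hne
        obtain ⟨y1, y2⟩ := y
        obtain ⟨x1, x2⟩ := x
        simp only [bar] at *
        subst h1
        cases y2 <;> cases x2 <;> simp_all
      subst hy
      obtain ⟨h1, h2⟩ := toWord_mk_of_append (by simpa using hL)
      have : t * g x = FreeGroup.mk L := by rw [h2, g_bar]; group
      rw [this, h1]; simpa using hL

section
variable {n : ℕ} {H : Subgroup (FreeGroup (Fin n))} {T : Set (FreeGroup (Fin n))}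

lemma parent (hT : IsSchreierTransversal H T) {t : FreeGroup (Fin n)} (ht : t ∈ T) (h1 : t ≠ 1) :
    ∃ s ∈ T, ∃ x, t = s * g x ∧ t.norm = s.norm + 1 := by
  rcases List.eq_nil_or_concat t.toWord with h0 | ⟨L, y, hL⟩
  · exact absurd (FreeGroup.toWord_eq_nil_iff.1 h0) h1
  · have hL : t.toWord = L ++ [y] := by simpa using hL
    obtain ⟨h2, h3⟩ := toWord_mk_of_append hL
    refine ⟨FreeGroup.mk L, ?_, y, h3, ?_⟩
    · have := hT.2 t ht L.length
      rwa [hL, List.take_left'] at this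
      rfl
    · rw [FreeGroup.norm, FreeGroup.norm, h2, hL]; simp

lemma one_mem (hT : IsSchreierTransversal H T) : (1 : FreeGroup (Fin n)) ∈ T := by
  obtain ⟨t, ⟨ht, _⟩, _⟩ := hT.1 1
  have := hT.2 t ht 0
  simpa [← FreeGroup.one_eq_mk] using this

/-- representative -/
noncomputable def rep (hT : IsSchreierTransversal H T) (w : FreeGroup (Fin n)) : T :=
  ⟨(hT.1 w).choose, (hT.1 w).choose_spec.1.1⟩

lemma rep_spec (hT : IsSchreierTransversal H T) (w : FreeGroup (Fin n)) :
    w * (rep hT w : FreeGroup (Fin n))⁻¹ ∈ H := (hT.1 w).choose_spec.1.2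

lemma rep_eq (hT : IsSchreierTransversal H T) {w : FreeGroup (Fin n)} {t : T}
    (h : w * (t : FreeGroup (Fin n))⁻¹ ∈ H) : rep hT w = t :=
  Subtype.ext ((hT.1 w).unique ⟨(rep hT w).2, rep_spec hT w⟩ ⟨t.2, h⟩)

lemma rep_self (hT : IsSchreierTransversal H T) (t : T) : rep hT (t : FreeGroup (Fin n)) = t :=
  rep_eq hT (by simp)

lemma rep_cancel (hT : IsSchreierTransversal H T) (t : T) (w : FreeGroup (Fin n)) :
    rep hT ((rep hT (t * w) : FreeGroup (Fin n)) * w⁻¹) = t := by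
  apply rep_eq
  have := H.inv_mem (rep_spec hT (t * w))
  convert this using 1
  group

lemma rep_cancel' (hT : IsSchreierTransversal H T) (t : T) (w : FreeGroup (Fin n)) :
    rep hT ((rep hT (t * w⁻¹) : FreeGroup (Fin n)) * w) = t := by
  simpa using rep_cancel hT t w⁻¹

/-- positive non-tree edges -/
abbrev E (T : Set (FreeGroup (Fin n))) : Type :=
  {p : FreeGroup (Fin n) × Fin n // p.1 ∈ T ∧ p.1 * FreeGroup.of p.2 ∉ T}

open Classical in
/-- edge label -/
noncomputable def lab (t : T) (a : Fin n) : FreeGroup (E T) :=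
  if h : (t : FreeGroup (Fin n)) * FreeGroup.of a ∉ T then FreeGroup.of ⟨(t, a), t.2, h⟩ else 1

lemma lab_tree (t : T) (a : Fin n) (h : (t : FreeGroup (Fin n)) * FreeGroup.of a ∈ T) :
    lab t a = 1 := by simp [lab, h]

/-- The right multiplication by a generator. -/
noncomputable def sig (hT : IsSchreierTransversal H T) (a : Fin n) :
    Equiv.Perm (FreeGroup (E T) × T) where
  toFun q := (q.1 * lab q.2 a, rep hT (q.2 * FreeGroup.of a))
  invFun q := (q.1 * (lab (rep hT (q.2 * (FreeGroup.of a)⁻¹)) a)⁻¹,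
    rep hT (q.2 * (FreeGroup.of a)⁻¹))
  left_inv q := by simp [rep_cancel]
  right_inv q := by simp [rep_cancel']

/-- action hom -/
noncomputable def rho (hT : IsSchreierTransversal H T) :
    FreeGroup (Fin n) →* Equiv.Perm (FreeGroup (E T) × T) :=
  FreeGroup.lift (fun a => (sig hT a)⁻¹)

/-- right action -/
noncomputable def act (hT : IsSchreierTransversal H T) (q : FreeGroup (E T) × T)
    (w : FreeGroup (Fin n)) : FreeGroup (E T) × T := rho hT w⁻¹ q

lemma act_one (hT : IsSchreierTransversal H T) (q) : act hT q 1 = q := by simp [act]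

lemma act_mul (hT : IsSchreierTransversal H T) (q v w) :
    act hT q (v * w) = act hT (act hT q v) w := by simp [act]

lemma act_of (hT : IsSchreierTransversal H T) (q) (a : Fin n) :
    act hT q (FreeGroup.of a) = (q.1 * lab q.2 a, rep hT (q.2 * FreeGroup.of a)) := by
  simp [act, rho]; rfl

lemma act_eq_iff (hT : IsSchreierTransversal H T) (q q' w) :
    act hT q w⁻¹ = q' ↔ q = act hT q' w := by
  constructor
  · rintro rfl; rw [← act_mul]; simp [act_one]
  · rintro rfl; rw [← act_mul]; simp [act_one]

lemma act_equiv (hT : IsSchreierTransversal H T) (w : FreeGroup (Fin n)) :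
    ∀ (v u : FreeGroup (E T)) (t : T),
      act hT (v * u, t) w = (v * (act hT (u, t) w).1, (act hT (u, t) w).2) := by
  induction w using FreeGroup.induction_on with
  | C1 => intro v u t; simp [act_one]
  | of a => intro v u t; simp [act_of, mul_assoc]
  | inv_of a ih =>
    intro v u t
    rw [act_eq_iff, ih, Prod.mk.eta, ← act_mul]; simp [act_one]
  | mul x y hx hy =>
    intro v u t
    rw [act_mul, hx, hy, act_mul]

/-- Schreier generators -/
noncomputable def theta (hT : IsSchreierTransversal H T) : FreeGroup (E T) →* H :=
  FreeGroup.lift (fun e => ⟨e.1.1 * FreeGroup.of e.1.2 *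
    (rep hT (e.1.1 * FreeGroup.of e.1.2) : FreeGroup (Fin n))⁻¹, rep_spec hT _⟩)

lemma theta_lab (hT : IsSchreierTransversal H T) (t : T) (a : Fin n) :
    (theta hT (lab t a) : FreeGroup (Fin n)) * (rep hT (t * FreeGroup.of a) : FreeGroup (Fin n))
      = t * FreeGroup.of a := by
  by_cases h : (t : FreeGroup (Fin n)) * FreeGroup.of a ∈ T
  · rw [lab_tree t a h]
    have := rep_self hT ⟨_, h⟩
    simp only at this
    rw [this]; simp
  · simp [lab, h, theta]

lemma act_val (hT : IsSchreierTransversal H T) (w : FreeGroup (Fin n)) :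
    ∀ q : FreeGroup (E T) × T,
      (theta hT (act hT q w).1 : FreeGroup (Fin n)) * ((act hT q w).2 : FreeGroup (Fin n))
        = theta hT q.1 * q.2 * w := by
  induction w using FreeGroup.induction_on with
  | C1 => intro q; simp [act_one]
  | of a =>
    intro q
    rw [act_of]
    change (theta hT (q.1 * lab q.2 a) : FreeGroup (Fin n)) * _ = _
    rw [(theta hT).map_mul, Subgroup.coe_mul, mul_assoc, theta_lab, mul_assoc]
  | inv_of a ih =>
    intro q
    have := ih (act hT q (FreeGroup.of a)⁻¹)
    rw [← act_mul, inv_mul_cancel, act_one] at this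
    rw [this]; group
  | mul x y hx hy =>
    intro q
    rw [act_mul, hy, hx]; group

lemma act_tree (hT : IsSchreierTransversal H T) (m : ℕ) : ∀ t : T, (t : FreeGroup (Fin n)).norm = m →
    act hT (1, ⟨1, one_mem hT⟩) t = (1, t) := by
  induction m with
  | zero =>
    rintro ⟨t, ht⟩ h
    have : t = 1 := FreeGroup.norm_eq_zero.1 h
    subst this
    simp [act_one]
  | succ m ih =>
    rintro ⟨t, ht⟩ h
    simp only at h
    have h1 : t ≠ 1 := by rintro rfl; simp at h
    obtain ⟨s, hs, ⟨a, b⟩, hx, hnorm⟩ := parent hT ht h1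
    have := ih ⟨s, hs⟩ (by simp; omega)
    simp only at this ⊢
    have hact : act hT (1, ⟨1, one_mem hT⟩) t = act hT (1, ⟨s, hs⟩) (g (a, b)) := by
      rw [hx, act_mul, this]
    rw [hact]
    cases b with
    | true =>
      rw [g_true] at *
      rw [act_of, lab_tree _ _ (by simpa [hx] using ht)]
      have := rep_self hT ⟨t, ht⟩
      simp only [hx] at this
      simp [this, hx]
    | false =>
      rw [g_false] at *
      have hst : s = t * FreeGroup.of a := by rw [hx]; group
      rw [act_eq_iff, act_of, lab_tree _ _ (by simpa [← hst] using hs)]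
      have := rep_self hT ⟨s, hs⟩
      simp only at this
      simp [← hst, this]

lemma act_H (hT : IsSchreierTransversal H T) (h : H) :
    (act hT (1, ⟨1, one_mem hT⟩) (h : FreeGroup (Fin n))).2 = ⟨1, one_mem hT⟩ := by
  have h1 := act_val hT h (1, ⟨1, one_mem hT⟩)
  set q := act hT (1, ⟨1, one_mem hT⟩) (h : FreeGroup (Fin n)) with hq
  have h2 : (q.2 : FreeGroup (Fin n)) ∈ H := by
    have : (q.2 : FreeGroup (Fin n)) = (((theta hT q.1)⁻¹ * h : H) : FreeGroup (Fin n)) := by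
      simp at h1
      simp [← h1]
    rw [this]; exact SetLike.coe_mem _
  rw [← rep_self hT q.2]
  apply rep_eq
  simpa using h2

lemma theta_bij (hT : IsSchreierTransversal H T) : Function.Bijective (theta hT) := by
  constructor
  · let ψ : H →* FreeGroup (E T) :=
      { toFun := fun h => (act hT (1, ⟨1, one_mem hT⟩) (h : FreeGroup (Fin n))).1
        map_one' := by simp [act_one]
        map_mul' := by
          intro x y
          simp only [Subgroup.coe_mul]
          rw [act_mul]
          have e : act hT (1, ⟨1, one_mem hT⟩) (x : FreeGroup (Fin n)) =
            ((act hT (1, ⟨1, one_mem hT⟩) (x : FreeGroup (Fin n))).1 * 1, ⟨1, one_mem hT⟩) := by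
            exact Prod.ext (mul_one _).symm (act_H hT x)
          rw [e, act_equiv]
          simp }
    have hid : ψ.comp (theta hT) = MonoidHom.id _ := by
      ext e
      simp only [MonoidHom.comp_apply, MonoidHom.id_apply]
      obtain ⟨⟨t, a⟩, ht, hta⟩ := e
      simp only at ht hta
      have e2 : (theta hT (FreeGroup.of ⟨(t, a), ht, hta⟩) : FreeGroup (Fin n)) =
        t * FreeGroup.of a * (rep hT (t * FreeGroup.of a) : FreeGroup (Fin n))⁻¹ := by
        simp [theta]
      change (act hT (1, ⟨1, one_mem hT⟩) (theta hT _ : FreeGroup (Fin n))).1 = _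
      rw [e2, act_mul, act_mul]
      have h1 := act_tree hT _ ⟨t, ht⟩ rfl
      have h2 := act_tree hT _ (rep hT (t * FreeGroup.of a)) rfl
      simp only at h1
      rw [h1, act_of]
      have h3 : act hT (1 * lab ⟨t, ht⟩ a, rep hT (t * FreeGroup.of a))
          (rep hT (t * FreeGroup.of a) : FreeGroup (Fin n))⁻¹
          = (lab ⟨t, ht⟩ a, ⟨1, one_mem hT⟩) := by
        rw [act_eq_iff]
        have := act_equiv hT (rep hT (t * FreeGroup.of a)) (lab ⟨t, ht⟩ a) 1 ⟨1, one_mem hT⟩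
        rw [mul_one] at this
        rw [this, h2]; simp
      simp only [h3]
      simp [lab, hta]
    intro x y hxy
    have := congrArg ψ hxy
    have hx := DFunLike.congr_fun hid x
    have hy := DFunLike.congr_fun hid y
    simp only [MonoidHom.comp_apply, MonoidHom.id_apply] at hx hy
    rw [← hx, ← hy, this]
  · intro h
    refine ⟨(act hT (1, ⟨1, one_mem hT⟩) (h : FreeGroup (Fin n))).1, ?_⟩
    have h1 := act_val hT h (1, ⟨1, one_mem hT⟩)
    rw [act_H] at h1
    apply Subtype.ext
    simpa using h1

lemma basis_equiv (hT : IsSchreierTransversal H T) {B : Set (FreeGroup (Fin n))}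
    (hB : IsFreeBasis H B) : Nonempty (B ≃ E T) := by
  obtain ⟨h1, h2⟩ := hB
  exact ⟨Equiv.ofFreeGroupEquiv ((MulEquiv.ofBijective _ h2).trans
    (MulEquiv.ofBijective _ (theta_bij hT)).symm)⟩

end

section
variable {n : ℕ} {H : Subgroup (FreeGroup (Fin n))} {T : Set (FreeGroup (Fin n))}

lemma finite_ball (i : ℕ) : {t : FreeGroup (Fin n) | t.norm ≤ i}.Finite :=
  Set.Finite.of_finite_image ((List.finite_length_le (Fin n × Bool) i).subset (by
    rintro _ ⟨t, ht, rfl⟩; exact ht)) FreeGroup.toWord_injective.injOn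

lemma finite_Tle (i : ℕ) : {t ∈ T | FreeGroup.norm t ≤ i}.Finite :=
  (finite_ball i).subset (fun _ h => h.2)

lemma norm_step (t : FreeGroup (Fin n)) (x : Fin n × Bool) :
    (t * g x).norm = t.norm + 1 ∨ t.norm = (t * g x).norm + 1 := by
  rcases step t x with h | h
  · left; simp [FreeGroup.norm, h]
  · right; rw [FreeGroup.norm, h]; simp [FreeGroup.norm]

lemma toWord_up {t : FreeGroup (Fin n)} {x : Fin n × Bool}
    (h : (t * g x).norm = t.norm + 1) : (t * g x).toWord = t.toWord ++ [x] := by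
  rcases step t x with h' | h'
  · exact h'
  · have : t.norm = (t * g x).norm + 1 := by rw [FreeGroup.norm, h']; simp [FreeGroup.norm]
    omega

/-- upward tree edges -/
def U (T : Set (FreeGroup (Fin n))) (j : ℕ) : Set (FreeGroup (Fin n) × (Fin n × Bool)) :=
  {p | p.1 ∈ T ∧ p.1 * g p.2 ∈ T ∧ (p.1 * g p.2).norm = p.1.norm + 1 ∧ p.1.norm + 1 ≤ j}

/-- non-tree half-edges, in a ball -/
def Non (T : Set (FreeGroup (Fin n))) (i : ℕ) : Set (FreeGroup (Fin n) × (Fin n × Bool)) :=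
  {p | p.1 ∈ T ∧ p.1.norm ≤ i ∧ p.1 * g p.2 ∉ T}

/-- all non-tree half-edges -/
def NonAll (T : Set (FreeGroup (Fin n))) : Set (FreeGroup (Fin n) × (Fin n × Bool)) :=
  {p | p.1 ∈ T ∧ p.1 * g p.2 ∉ T}

/-- edge reversal -/
def rev (p : FreeGroup (Fin n) × (Fin n × Bool)) : FreeGroup (Fin n) × (Fin n × Bool) :=
  (p.1 * g p.2, bar p.2)

lemma rev_rev (p : FreeGroup (Fin n) × (Fin n × Bool)) : rev (rev p) = p := by
  simp [rev, g_bar, bar_bar]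

lemma rev_inj : Function.Injective (rev (n := n)) :=
  Function.LeftInverse.injective (g := rev) rev_rev

lemma U_finite (j : ℕ) : (U T j).Finite :=
  ((finite_ball j).prod Set.finite_univ).subset (by
    rintro p ⟨_, _, _, h⟩; exact ⟨by simp; omega, trivial⟩)

lemma Non_finite (j : ℕ) : (Non T j).Finite :=
  ((finite_ball j).prod Set.finite_univ).subset (by
    rintro p ⟨_, h, _⟩; exact ⟨h, trivial⟩)

lemma U_card (hT : IsSchreierTransversal H T) (j : ℕ) : (U T j).ncard + 1 = GammaT T j := by
  have himg : (fun p : FreeGroup (Fin n) × (Fin n × Bool) => p.1 * g p.2) '' U T j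
      = {t ∈ T | FreeGroup.norm t ≤ j} \ {1} := by
    ext t
    constructor
    · rintro ⟨p, ⟨h1, h2, h3, h4⟩, rfl⟩
      refine ⟨⟨h2, by simp only; omega⟩, ?_⟩
      intro h
      simp only [Set.mem_singleton_iff] at h
      rw [h] at h3; simp at h3
    · rintro ⟨⟨h1, h2⟩, h3⟩
      obtain ⟨s, hs, x, hx, hn⟩ := parent hT h1 h3
      refine ⟨(s, x), ⟨hs, ?_, ?_, ?_⟩, hx.symm⟩
      · simpa [← hx] using h1
      · simpa [← hx] using hn
      · simp only; omega
  have hinj : Set.InjOn (fun p : FreeGroup (Fin n) × (Fin n × Bool) => p.1 * g p.2) (U T j) := by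
    rintro ⟨t, x⟩ ⟨_, _, h, _⟩ ⟨s, y⟩ ⟨_, _, h', _⟩ heq
    simp only at h h' heq
    have e1 := toWord_up h
    have e2 := toWord_up h'
    rw [heq, e2] at e1
    obtain ⟨h5, h6⟩ := List.append_inj' e1 rfl
    have := FreeGroup.toWord_injective h5
    simp at h6
    rw [this, h6]
  rw [GammaT, ← Set.ncard_image_of_injOn hinj, himg]
  exact Set.ncard_sdiff_singleton_add_one ⟨one_mem hT, by simp⟩ (finite_Tle j)

lemma Gamma_succ (i : ℕ) : GammaT T (i + 1) = GammaT T i + gammaT T (i + 1) := by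
  rw [GammaT, GammaT, gammaT, ← Set.ncard_union_eq _ (finite_Tle i)
    ((finite_Tle (T := T) (i + 1)).subset fun t h => ⟨h.1, h.2.le⟩)]
  · congr 1
    ext t
    simp only [Set.mem_setOf_eq, Set.mem_union]
    constructor
    · rintro ⟨h1, h2⟩
      rcases Nat.lt_or_ge i t.norm with h | h
      · exact Or.inr ⟨h1, by omega⟩
      · exact Or.inl ⟨h1, h⟩
    · rintro (⟨h1, h2⟩ | ⟨h1, h2⟩) <;> exact ⟨h1, by omega⟩
  · rw [Set.disjoint_left]
    rintro t ⟨_, h⟩ ⟨_, h'⟩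
    omega

lemma count (hT : IsSchreierTransversal H T) (i : ℕ) :
    (Non T i).ncard + ((U T (i + 1)).ncard + (U T i).ncard) = GammaT T i * (n * 2) := by
  rw [← Set.ncard_image_of_injective (U T i) rev_inj,
    ← Set.ncard_union_eq _ (U_finite _) ((U_finite _).image _),
    ← Set.ncard_union_eq _ (Non_finite _) ((U_finite _).union ((U_finite _).image _))]
  · have : Non T i ∪ (U T (i + 1) ∪ rev '' U T i) =
        {t ∈ T | FreeGroup.norm t ≤ i} ×ˢ (Set.univ : Set (Fin n × Bool)) := by
      ext ⟨t, x⟩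
      simp only [Set.mem_union, Set.mem_prod, Set.mem_univ, and_true, Set.mem_setOf_eq]
      constructor
      · rintro (⟨h1, h2, h3⟩ | ⟨h1, h2, h3, h4⟩ | ⟨p, ⟨h1, h2, h3, h4⟩, hp⟩)
        · exact ⟨h1, h2⟩
        · exact ⟨h1, by simp only at h4; omega⟩
        · have : p.1 * g p.2 = t := congrArg Prod.fst hp
          rw [this] at h2 h3
          exact ⟨h2, by omega⟩
      · rintro ⟨h1, h2⟩
        by_cases h : t * g x ∈ T
        · right
          rcases norm_step t x with h' | h'
          · left; exact ⟨h1, h, h', by simp only; omega⟩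
          · right
            refine ⟨rev (t, x), ⟨h, ?_, ?_, ?_⟩, rev_rev _⟩
            · simpa [rev, g_bar] using h1
            · simpa [rev, g_bar] using h'
            · simp only [rev]; omega
        · left; exact ⟨h1, h2, h⟩
    rw [this, Set.ncard_prod, GammaT]
    simp [Set.ncard_univ, Nat.card_eq_fintype_card]
  · rw [Set.disjoint_left]
    rintro q ⟨h1, h2, h3⟩ (⟨_, h, _⟩ | ⟨p, ⟨h, _⟩, rfl⟩)
    · exact h3 h
    · simp [rev, g_bar] at h3; exact h3 h
  · rw [Set.disjoint_left]
    rintro q ⟨h1, h2, h3, _⟩ ⟨p, ⟨_, _, h, _⟩, rfl⟩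
    simp [rev, g_bar] at h3 h
    omega

lemma rT_eq (hT : IsSchreierTransversal H T) (i : ℕ) : rT n T i = ((Non T i).ncard : ℚ) / 2 := by
  have h1 := count hT i
  have h2 := U_card hT (i + 1)
  have h3 := U_card hT i
  have h4 := Gamma_succ (T := T) i
  rw [rT]
  have h1' : ((Non T i).ncard : ℚ) + ((U T (i + 1)).ncard + (U T i).ncard)
    = GammaT T i * (n * 2) := by exact_mod_cast h1
  have h2' : ((U T (i + 1)).ncard : ℚ) + 1 = GammaT T (i + 1) := by exact_mod_cast h2
  have h3' : ((U T i).ncard : ℚ) + 1 = GammaT T i := by exact_mod_cast h3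
  have h4' : (GammaT T (i + 1) : ℚ) = GammaT T i + gammaT T (i + 1) := by exact_mod_cast h4
  linarith

lemma Non_mono : Monotone (Non T) := fun _ _ h _ hp => ⟨hp.1, hp.2.1.trans h, hp.2.2⟩

lemma rep_not_mem (hT : IsSchreierTransversal H T) (t : T) (w : FreeGroup (Fin n))
    (h : (t : FreeGroup (Fin n)) * w ∉ T) :
    (rep hT (t * w) : FreeGroup (Fin n)) * w⁻¹ ∉ T := by
  intro h'
  have h1 := rep_self hT ⟨_, h'⟩
  simp only at h1
  rw [rep_cancel] at h1
  apply h
  rw [h1]; simp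

/-- negative half-edges correspond to positive edges -/
noncomputable def NonEquiv (hT : IsSchreierTransversal H T) : NonAll T ≃ E T × Bool where
  toFun p := if h : p.1.2.2 = true then (⟨(p.1.1, p.1.2.1), p.2.1, by
      have := p.2.2
      rwa [show p.1.2 = (p.1.2.1, true) from Prod.ext rfl h, g_true] at this⟩, true)
    else (⟨(rep hT (p.1.1 * (FreeGroup.of p.1.2.1)⁻¹), p.1.2.1), Subtype.coe_prop _, by
      have := p.2.2
      rw [show p.1.2 = (p.1.2.1, false) from Prod.ext rfl (by simpa using h), g_false] at this
      have := rep_not_mem hT ⟨p.1.1, p.2.1⟩ _ this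
      simpa using this⟩, false)
  invFun q := match q with
    | (e, true) => ⟨(e.1.1, (e.1.2, true)), e.2.1, e.2.2⟩
    | (e, false) => ⟨(rep hT (e.1.1 * FreeGroup.of e.1.2), (e.1.2, false)), Subtype.coe_prop _, by
        have := rep_not_mem hT ⟨e.1.1, e.2.1⟩ _ e.2.2
        simpa [g_false] using this⟩
  left_inv := by
    rintro ⟨⟨t, a, b⟩, ht, h⟩
    cases b
    · have := rep_cancel' hT ⟨t, ht⟩ (FreeGroup.of a)
      simp only at this
      simp [this]
    · simp
  right_inv := by
    rintro ⟨⟨⟨t, a⟩, ht, h⟩, b⟩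
    cases b
    · have := rep_cancel hT ⟨t, ht⟩ (FreeGroup.of a)
      simp only at this
      simp [this]
    · simp

end

end SchreierRank

/-- For any Schreier transversal `T` of `H`, the sequence
`r_T(i) = 1 + (n−1)·Γ_T(i) − γ_T(i+1)/2` is nondecreasing and converges
(in `[0,∞]`) to the rank of `H`. -/
theorem rank_eq_lim_rT {n : ℕ} (hn : 1 ≤ n) (H : Subgroup (FreeGroup (Fin n)))
    (T : Set (FreeGroup (Fin n))) (hT : IsSchreierTransversal H T)
    (B : Set (FreeGroup (Fin n))) (hB : IsFreeBasis H B) :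
    Monotone (rT n T) ∧
    Filter.Tendsto (fun i => ((rT n T i : ℝ) : EReal)) Filter.atTop
      (nhds (rankEReal B)) := by
  classical
  open SchreierRank in
  refine ⟨fun i j hij => ?_, ?_⟩
  · rw [rT_eq hT, rT_eq hT]
    have := Set.ncard_le_ncard (Non_mono (T := T) hij) (Non_finite j)
    have : ((Non T i).ncard : ℚ) ≤ (Non T j).ncard := by exact_mod_cast this
    linarith
  · obtain ⟨e⟩ := basis_equiv hT hB
    have e2 : NonAll T ≃ B × Bool :=
      (NonEquiv hT).trans (Equiv.prodCongr e.symm (Equiv.refl _))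
    have hsub : ∀ S : Finset (FreeGroup (Fin n) × (Fin n × Bool)), (S : Set _) ⊆ NonAll T →
        ∀ᶠ i in Filter.atTop, (S : Set _) ⊆ Non T i := by
      intro S hS
      filter_upwards [Filter.eventually_ge_atTop (S.sup fun p => p.1.norm)] with i hi p hp
      exact ⟨(hS hp).1, (Finset.le_sup (f := fun p => p.1.norm) hp).trans hi, (hS hp).2⟩
    have hNA : ∀ i, Non T i ⊆ NonAll T := fun i p hp => ⟨hp.1, hp.2.2⟩
    have hr : ∀ i, ((rT n T i : ℚ) : ℝ) = ((Non T i).ncard : ℝ) / 2 := by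
      intro i; rw [rT_eq hT]; push_cast; rfl
    by_cases hfin : B.Finite
    · rw [rankEReal, dif_pos hfin]
      have : Finite B := hfin
      have hNfin : (NonAll T).Finite := Finite.of_equiv _ e2.symm
      have hcard : (NonAll T).ncard = hfin.toFinset.card * 2 := by
        rw [← Nat.card_coe_set_eq, Nat.card_congr e2, Nat.card_prod, Nat.card_coe_set_eq,
          Set.ncard_eq_toFinset_card B hfin]
        simp
      apply tendsto_const_nhds.congr'
      filter_upwards [hsub hNfin.toFinset (by simp)] with i hi
      have : Non T i = NonAll T := (hNA i).antisymm (by simpa using hi)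
      rw [hr, this, hcard]
      congr 1
      push_cast
      ring
    · rw [rankEReal, dif_neg hfin, EReal.tendsto_nhds_top_iff_real]
      intro x
      have hinf : (NonAll T).Infinite := by
        intro h
        apply hfin
        have : Finite (NonAll T) := h
        have : Finite (B × Bool) := Finite.of_equiv _ e2
        exact Finite.of_injective (fun b : B => (b, true)) (fun a b h => by simpa using h)
      obtain ⟨m, hm⟩ := exists_nat_gt (2 * x)
      obtain ⟨S, hS, hSc⟩ := hinf.exists_subset_card_eq m
      filter_upwards [hsub S hS] with i hi
      rw [hr, EReal.coe_lt_coe_iff]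
      have := Set.ncard_le_ncard hi (Non_finite i)
      rw [Set.ncard_coe_finset, hSc] at this
      have : (m : ℝ) ≤ (Non T i).ncard := by exact_mod_cast this
      linarith
end

section
/- Let H be a subgroup of F. Then rank(H) = 1 + lim_{i→∞} ( (n−1)·Γ_{F/H}(i) − γ_{F/H}(i+1)/2 ), where the sequence 1 + (n−1)·Γ_{F/H}(i) − γ_{F/H}(i+1)/2 of rational numbers is nondecreasing and its limit exists in [0, ∞]. -/
open FreeGroup

/-- The minimal length of a representative of the right coset `C` of `H`. -/
noncomputable def cosetMinLen {n : ℕ} (H : Subgroup (FreeGroup (Fin n)))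
    (C : Quotient (QuotientGroup.rightRel H)) : ℕ :=
  sInf (FreeGroup.norm '' {g | Quotient.mk (QuotientGroup.rightRel H) g = C})

/-- The cogrowth function `Γ_{F/H}(i)`: the number of right cosets of `H`
whose shortest representative has length at most `i`. -/
noncomputable def cogrowth {n : ℕ} (H : Subgroup (FreeGroup (Fin n))) (i : ℕ) : ℕ :=
  Nat.card {C : Quotient (QuotientGroup.rightRel H) // cosetMinLen H C ≤ i}

/-- `γ_{F/H}(i)`: the number of right cosets of `H` whose shortest
representative has length exactly `i`. -/
noncomputable def cogrowthExact {n : ℕ} (H : Subgroup (FreeGroup (Fin n))) (i : ℕ) : ℕ :=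
  Nat.card {C : Quotient (QuotientGroup.rightRel H) // cosetMinLen H C = i}

/-- `r_H(i) = 1 + (n−1)·Γ_{F/H}(i) − γ_{F/H}(i+1)/2`. -/
noncomputable def rH (n : ℕ) (H : Subgroup (FreeGroup (Fin n))) (i : ℕ) : ℚ :=
  1 + ((n : ℚ) - 1) * (cogrowth H i : ℚ) - (cogrowthExact H (i + 1) : ℚ) / 2

namespace CG

variable {n : ℕ} (H : Subgroup (FreeGroup (Fin n)))

/-- right cosets -/
abbrev V := Quotient (QuotientGroup.rightRel H)

/-- coset of an element -/
def cl (g : FreeGroup (Fin n)) : V H := Quotient.mk (QuotientGroup.rightRel H) g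

theorem cl_eq {g k : FreeGroup (Fin n)} : cl H g = cl H k ↔ k * g⁻¹ ∈ H := by
  unfold cl
  rw [Quotient.eq, QuotientGroup.rightRel_apply]

theorem cl_surj (v : V H) : ∃ g, cl H g = v := Quotient.exists_rep v

/-- right multiplication -/
def act (v : V H) (g : FreeGroup (Fin n)) : V H :=
  Quotient.map' (s₁ := QuotientGroup.rightRel H) (s₂ := QuotientGroup.rightRel H)
    (fun k => k * g) (by
      intro a b h
      rw [QuotientGroup.rightRel_apply] at h ⊢
      simpa [mul_assoc] using h) v

@[simp] theorem act_cl (g k : FreeGroup (Fin n)) : act H (cl H g) k = cl H (g * k) := rfl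

@[simp] theorem act_one (v : V H) : act H v 1 = v := by
  obtain ⟨g, rfl⟩ := cl_surj H v; simp

@[simp] theorem act_act (v : V H) (g k) : act H (act H v g) k = act H v (g * k) := by
  obtain ⟨g, rfl⟩ := cl_surj H v; simp [mul_assoc]

/-- root -/
def v0 : V H := cl H 1

theorem act_v0 (g) : act H (v0 H) g = cl H g := by simp [v0]

theorem cl_mem {h : FreeGroup (Fin n)} : cl H h = v0 H ↔ h ∈ H := by
  rw [v0, cl_eq]; simp

theorem len_le (g : FreeGroup (Fin n)) : cosetMinLen H (cl H g) ≤ g.norm :=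
  Nat.sInf_le ⟨g, rfl, rfl⟩

theorem len_attained (v : V H) : ∃ g, cl H g = v ∧ g.norm = cosetMinLen H v := by
  obtain ⟨g, hg⟩ := cl_surj H v
  have := Nat.sInf_mem (s := FreeGroup.norm '' {g | Quotient.mk (QuotientGroup.rightRel H) g = v})
    ⟨_, g, hg, rfl⟩
  obtain ⟨k, hk, hk'⟩ := this
  exact ⟨k, hk, hk'⟩

theorem len_act (v : V H) (g : FreeGroup (Fin n)) :
    cosetMinLen H (act H v g) ≤ cosetMinLen H v + g.norm := by
  obtain ⟨k, rfl, hk⟩ := len_attained H v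
  rw [← hk, act_cl]
  exact (len_le H _).trans (FreeGroup.norm_mul_le _ _)

theorem len_v0 : cosetMinLen H (v0 H) = 0 := by
  have := len_le H 1
  rw [FreeGroup.norm_one] at this
  exact Nat.le_zero.1 this

theorem len_eq_zero {v : V H} : cosetMinLen H v = 0 ↔ v = v0 H := by
  constructor
  · intro h
    obtain ⟨k, rfl, hk⟩ := len_attained H v
    rw [h, FreeGroup.norm_eq_zero] at hk
    rw [hk]; rfl
  · rintro rfl; exact len_v0 H

theorem ball_finite (i : ℕ) : {v : V H | cosetMinLen H v ≤ i}.Finite := by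
  have h1 : {g : FreeGroup (Fin n) | g.norm ≤ i}.Finite := by
    refine Set.Finite.of_finite_image (f := FreeGroup.toWord) ?_
      (FreeGroup.toWord_injective.injOn)
    refine (List.finite_length_le (Fin n × Bool) i).subset ?_
    rintro _ ⟨g, hg, rfl⟩
    exact hg
  refine (h1.image (cl H)).subset ?_
  intro v hv
  obtain ⟨k, rfl, hk⟩ := len_attained H v
  exact ⟨k, by simpa [hk] using hv, rfl⟩

/-- letter -/
def letter (a : Fin n × Bool) : FreeGroup (Fin n) := if a.2 then of a.1 else (of a.1)⁻¹

theorem norm_letter (a : Fin n × Bool) : (letter a).norm = 1 := by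
  unfold letter; split <;> simp

theorem mk_single (a : Fin n × Bool) : FreeGroup.mk [a] = letter a := by
  obtain ⟨x, b⟩ := a
  cases b
  · simp [letter, FreeGroup.of, FreeGroup.inv_mk, FreeGroup.invRev]
  · simp [letter, FreeGroup.of]

theorem parent_exists (v : V H) (hv : v ≠ v0 H) :
    ∃ q : V H × (Fin n × Bool), cosetMinLen H q.1 + 1 = cosetMinLen H v ∧
      act H q.1 (letter q.2) = v := by
  obtain ⟨k, rfl, hk⟩ := len_attained H v
  have hne : k.toWord ≠ [] := by
    intro h
    rw [FreeGroup.toWord_eq_nil_iff] at h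
    subst h; exact hv rfl
  set a := k.toWord.getLast hne with ha
  set g := FreeGroup.mk k.toWord.dropLast with hg
  have hkg : k = g * letter a := by
    rw [← mk_single, hg, FreeGroup.mul_mk, ha, List.dropLast_append_getLast, FreeGroup.mk_toWord]
  have hgn : g.norm + 1 ≤ k.norm := by
    have h1 : g.norm ≤ k.toWord.dropLast.length := FreeGroup.norm_mk_le
    have h2 : 0 < k.toWord.length := List.length_pos_iff.mpr hne
    rw [List.length_dropLast] at h1
    have : k.norm = k.toWord.length := rfl
    omega
  refine ⟨(cl H g, a), ?_, by simp [← hkg]⟩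
  have h3 := len_le H g
  have h4 := len_act H (cl H g) (letter a)
  rw [act_cl, ← hkg, norm_letter] at h4
  simp only
  omega

/-- chosen parent -/
noncomputable def par (v : V H) (hv : v ≠ v0 H) : V H × (Fin n × Bool) :=
  (parent_exists H v hv).choose

theorem par_len (v : V H) (hv : v ≠ v0 H) :
    cosetMinLen H (par H v hv).1 + 1 = cosetMinLen H v := (parent_exists H v hv).choose_spec.1

theorem par_act (v : V H) (hv : v ≠ v0 H) :
    act H (par H v hv).1 (letter (par H v hv).2) = v := (parent_exists H v hv).choose_spec.2

/-- chosen tree edge above `v` -/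
noncomputable def te (v : {v : V H // v ≠ v0 H}) : V H × Fin n :=
  if (par H v.1 v.2).2.2 then ((par H v.1 v.2).1, (par H v.1 v.2).2.1)
  else (v.1, (par H v.1 v.2).2.1)

/-- target -/
def tgt (e : V H × Fin n) : V H := act H e.1 (of e.2)

theorem te_ends (v : {v : V H // v ≠ v0 H}) :
    ((te H v).1 = (par H v.1 v.2).1 ∧ tgt H (te H v) = v.1) ∨
    ((te H v).1 = v.1 ∧ tgt H (te H v) = (par H v.1 v.2).1) := by
  have h := par_act H v.1 v.2
  unfold te letter tgt at *
  split_ifs with hb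
  · left
    simp only [hb, if_true] at h
    exact ⟨rfl, h⟩
  · right
    simp only [hb] at h
    refine ⟨rfl, ?_⟩
    simp only
    have h' := congrArg (fun w => act H w (of (par H v.1 v.2).2.1)) h
    simpa using h'.symm

theorem te_inj : Function.Injective (te H) := by
  intro v w h
  have h1 := par_len H v.1 v.2
  have h2 := par_len H w.1 w.2
  apply Subtype.ext
  rcases te_ends H v with ⟨a, b⟩ | ⟨a, b⟩ <;> rcases te_ends H w with ⟨c, d⟩ | ⟨c, d⟩ <;>
    rw [h] at a b
  · rw [← b, d]
  · have h3 := congrArg (cosetMinLen H) (a.symm.trans c)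
    have h4 := congrArg (cosetMinLen H) (b.symm.trans d)
    omega
  · have h3 := congrArg (cosetMinLen H) (a.symm.trans c)
    have h4 := congrArg (cosetMinLen H) (b.symm.trans d)
    omega
  · rw [← a, c]

/-- source in ball -/
def SA (i : ℕ) : Set (V H × Fin n) := {e | cosetMinLen H e.1 ≤ i}
/-- target in ball -/
def SB (i : ℕ) : Set (V H × Fin n) := {e | cosetMinLen H (tgt H e) ≤ i}
/-- non-tree edges -/
def N : Set (V H × Fin n) := (Set.range (te H))ᶜ

theorem te_inter (v : {v : V H // v ≠ v0 H}) (i : ℕ) :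
    te H v ∈ SA H i ∩ SB H i ↔ cosetMinLen H v.1 ≤ i := by
  have h1 := par_len H v.1 v.2
  rcases te_ends H v with ⟨a, b⟩ | ⟨a, b⟩ <;>
    simp only [SA, SB, Set.mem_inter_iff, Set.mem_ofPred_eq, a, b] <;> omega

theorem te_union (v : {v : V H // v ≠ v0 H}) (i : ℕ) :
    te H v ∈ SA H i ∪ SB H i ↔ cosetMinLen H v.1 ≤ i + 1 := by
  have h1 := par_len H v.1 v.2
  rcases te_ends H v with ⟨a, b⟩ | ⟨a, b⟩ <;>
    simp only [SA, SB, Set.mem_union, Set.mem_ofPred_eq, a, b] <;> omega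

theorem cogrowth_eq (i : ℕ) : cogrowth H i = {v : V H | cosetMinLen H v ≤ i}.ncard := rfl

theorem SA_eq (i : ℕ) : SA H i = {v : V H | cosetMinLen H v ≤ i} ×ˢ (Set.univ : Set (Fin n)) := by
  ext e; simp [SA]

theorem SA_finite (i : ℕ) : (SA H i).Finite := by
  rw [SA_eq]; exact (ball_finite H i).prod Set.finite_univ

theorem SA_card (i : ℕ) : (SA H i).ncard = cogrowth H i * n := by
  rw [SA_eq, Set.ncard_prod, cogrowth_eq]; simp

/-- edge flip -/
def flip : (V H × Fin n) ≃ (V H × Fin n) where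
  toFun e := (tgt H e, e.2)
  invFun e := (act H e.1 (of e.2)⁻¹, e.2)
  left_inv e := by simp [tgt]
  right_inv e := by simp [tgt]

theorem SB_eq (i : ℕ) : SB H i = (flip H).symm '' SA H i := by
  rw [Equiv.image_symm_eq_preimage]; rfl

theorem SB_finite (i : ℕ) : (SB H i).Finite := by
  rw [SB_eq]; exact (SA_finite H i).image _

theorem SB_card (i : ℕ) : (SB H i).ncard = cogrowth H i * n := by
  rw [SB_eq, Set.ncard_image_of_injective _ (Equiv.injective _), SA_card]

theorem tree_card (S : Set (V H × Fin n)) (hS : S.Finite) (i : ℕ)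
    (h : ∀ v, te H v ∈ S ↔ cosetMinLen H v.1 ≤ i) :
    S.ncard + 1 = (N H ∩ S).ncard + cogrowth H i := by
  have h1 : S = (N H ∩ S) ∪ te H '' {v | cosetMinLen H v.1 ≤ i} := by
    ext e
    by_cases he : e ∈ Set.range (te H)
    · obtain ⟨v, rfl⟩ := he
      rw [h]
      simp [N, (te_inj H).eq_iff]
    · simp only [N, Set.mem_union, Set.mem_inter_iff, Set.mem_compl_iff, he, not_false_eq_true,
        true_and]
      constructor
      · exact fun h => Or.inl h
      · rintro (h | ⟨v, -, rfl⟩)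
        · exact h
        · exact absurd ⟨v, rfl⟩ he
  have hsub : te H '' {v | cosetMinLen H v.1 ≤ i} ⊆ S := by
    rintro _ ⟨v, hv, rfl⟩; exact (h v).2 hv
  have hd : Disjoint (N H ∩ S) (te H '' {v | cosetMinLen H v.1 ≤ i}) := by
    rw [Set.disjoint_left]
    rintro _ ⟨he, -⟩ ⟨v, -, rfl⟩
    exact he ⟨v, rfl⟩
  have h2 : (te H '' {v | cosetMinLen H v.1 ≤ i}).ncard + 1 = cogrowth H i := by
    rw [Set.ncard_image_of_injective _ (te_inj H), cogrowth_eq,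
      ← Set.ncard_image_of_injective _ Subtype.val_injective]
    have : {v : V H | cosetMinLen H v ≤ i} = insert (v0 H)
        (Subtype.val '' {v : {v : V H // v ≠ v0 H} | cosetMinLen H v.1 ≤ i}) := by
      ext v
      by_cases hv : v = v0 H
      · subst hv; simp [len_v0]
      · simp [hv]
    have hfin := ball_finite H i
    have hfin' : (Subtype.val '' {v : {v : V H // v ≠ v0 H} | cosetMinLen H v.1 ≤ i}).Finite := by
      refine hfin.subset ?_
      rintro _ ⟨v, hv, rfl⟩; exact hv
    rw [this, Set.ncard_insert_of_notMem (by simp) hfin']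
  have h3 := Set.ncard_union_eq hd (hS.subset Set.inter_subset_right) (hS.subset hsub)
  rw [← h1] at h3
  omega

theorem cogrowth_succ (i : ℕ) : cogrowth H (i + 1) = cogrowth H i + cogrowthExact H (i + 1) := by
  have h0 : cogrowthExact H (i + 1) = {v : V H | cosetMinLen H v = i + 1}.ncard := rfl
  have hf : {v : V H | cosetMinLen H v = i + 1}.Finite :=
    (ball_finite H (i + 1)).subset fun v hv => le_of_eq hv
  rw [h0, cogrowth_eq, cogrowth_eq, ← Set.ncard_union_eq ?_ (ball_finite H i) hf]
  · congr 1; ext v; simp only [Set.mem_ofPred_eq, Set.mem_union]; omega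
  · rw [Set.disjoint_left]; intro v; simp only [Set.mem_ofPred_eq]; omega

/-- inner count -/
noncomputable def cN (i : ℕ) : ℕ := (N H ∩ (SA H i ∩ SB H i)).ncard
/-- outer count -/
noncomputable def cN' (i : ℕ) : ℕ := (N H ∩ (SA H i ∪ SB H i)).ncard

theorem rH_eq (i : ℕ) : rH n H i = ((cN H i : ℚ) + cN' H i) / 2 := by
  have h1 := tree_card H _ ((SA_finite H i).inter_of_left (SB H i)) i (fun v => te_inter H v i)
  have h2 := tree_card H _ ((SA_finite H i).union (SB_finite H i)) (i + 1)
    (fun v => te_union H v i)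
  have h3 := Set.ncard_union_add_ncard_inter (SA H i) (SB H i) (SA_finite H i) (SB_finite H i)
  rw [SA_card, SB_card] at h3
  rw [cogrowth_succ] at h2
  change _ = cN H i + _ at h1
  change _ = cN' H i + _ at h2
  unfold rH
  have h1' : ((SA H i ∩ SB H i).ncard : ℚ) + 1 = cN H i + cogrowth H i := by exact_mod_cast h1
  have h2' : ((SA H i ∪ SB H i).ncard : ℚ) + 1 =
    cN' H i + (cogrowth H i + cogrowthExact H (i + 1)) := by exact_mod_cast h2
  have h3' : ((SA H i ∪ SB H i).ncard : ℚ) + (SA H i ∩ SB H i).ncard =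
    cogrowth H i * n + cogrowth H i * n := by exact_mod_cast h3
  linarith

theorem len_tgt (e : V H × Fin n) : cosetMinLen H (tgt H e) ≤ cosetMinLen H e.1 + 1 := by
  simpa [tgt] using len_act H e.1 (of e.2)

theorem len_src (e : V H × Fin n) : cosetMinLen H e.1 ≤ cosetMinLen H (tgt H e) + 1 := by
  simpa [tgt] using len_act H (tgt H e) (of e.2)⁻¹

theorem cN_le (i : ℕ) : cN H i ≤ cN' H i :=
  Set.ncard_le_ncard (fun _ he => ⟨he.1, Or.inl he.2.1⟩)
    (((SA_finite H i).union (SB_finite H i)).subset Set.inter_subset_right)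

theorem cN'_le (i : ℕ) : cN' H i ≤ cN H (i + 1) := by
  refine Set.ncard_le_ncard (fun e he => ⟨he.1, ?_⟩)
    ((SA_finite H (i + 1)).subset fun e he => he.2.1)
  have h1 := len_tgt H e
  have h2 := len_src H e
  have h3 := he.2
  simp only [SA, SB, Set.mem_union, Set.mem_inter_iff, Set.mem_ofPred_eq] at h3 ⊢
  omega

theorem cN_le_rH (i : ℕ) : (cN H i : ℚ) ≤ rH n H i := by
  have : (cN H i : ℚ) ≤ cN' H i := by exact_mod_cast cN_le H i
  rw [rH_eq]; linarith

theorem rH_le_cN (i : ℕ) : rH n H i ≤ (cN H (i + 1) : ℚ) := by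
  have h : (cN H i : ℚ) ≤ cN' H i := by exact_mod_cast cN_le H i
  have : (cN' H i : ℚ) ≤ cN H (i + 1) := by exact_mod_cast cN'_le H i
  rw [rH_eq]; linarith

theorem rH_mono : Monotone (rH n H) :=
  monotone_nat_of_le_succ fun i => (rH_le_cN H i).trans (cN_le_rH H (i + 1))

theorem cN_mono : Monotone (cN H) :=
  monotone_nat_of_le_succ fun i => (cN_le H i).trans (cN'_le H i)

/-- any finite set of non-tree edges is eventually inside. -/
theorem finite_sub (S : Finset (V H × Fin n)) (hS : (S : Set _) ⊆ N H) :
    ∃ i, S.card ≤ cN H i := by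
  classical
  refine ⟨S.sup fun e => cosetMinLen H e.1 + 1, ?_⟩
  rw [← Set.ncard_coe_finset]
  refine Set.ncard_le_ncard (fun e he => ⟨hS he, ?_⟩) ((SA_finite H _).subset fun e he => he.2.1)
  have h1 : cosetMinLen H e.1 + 1 ≤ _ := Finset.le_sup (f := fun e => cosetMinLen H e.1 + 1) he
  have h2 := len_tgt H e
  exact ⟨le_trans (Nat.le_succ _) h1, h2.trans h1⟩

theorem tendsto_fin (h : (N H).Finite) :
    Filter.Tendsto (fun i => ((rH n H i : ℝ) : EReal)) Filter.atTop
      (nhds ((((N H).ncard : ℕ) : ℝ) : EReal)) := by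
  have hle : ∀ i, cN H i ≤ (N H).ncard := fun i => Set.ncard_le_ncard Set.inter_subset_left h
  obtain ⟨i, hi⟩ := finite_sub H h.toFinset (by simp)
  rw [← Set.ncard_eq_toFinset_card _ h] at hi
  have heq : ∀ j, i ≤ j → cN H j = (N H).ncard := fun j hj =>
    le_antisymm (hle j) (hi.trans (cN_mono H hj))
  refine tendsto_const_nhds.congr' ?_
  filter_upwards [Filter.eventually_ge_atTop i] with j hj
  have h1 := cN_le_rH H j
  have h2 := rH_le_cN H j
  rw [heq j hj] at h1
  rw [heq (j + 1) (by omega)] at h2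
  have : rH n H j = ((N H).ncard : ℚ) := le_antisymm h2 h1
  rw [this]; norm_num

theorem tendsto_inf (h : (N H).Infinite) :
    Filter.Tendsto (fun i => ((rH n H i : ℝ) : EReal)) Filter.atTop (nhds ⊤) := by
  rw [EReal.tendsto_nhds_top_iff_real]
  intro x
  obtain ⟨m, hm⟩ := exists_nat_gt x
  obtain ⟨S, hS, hc⟩ := h.exists_subset_card_eq m
  obtain ⟨i, hi⟩ := finite_sub H S hS
  filter_upwards [Filter.eventually_ge_atTop i] with j hj
  have h1 := (cN_le_rH H i).trans (rH_mono H hj)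
  have h2 : (m : ℚ) ≤ rH n H j := le_trans (by exact_mod_cast (hc ▸ hi)) h1
  have h3 : (m : ℝ) ≤ (rH n H j : ℝ) := by exact_mod_cast h2
  exact_mod_cast hm.trans_le h3

/-! ### The cocycle -/

/-- generator permutation -/
def gperm (f : V H × Fin n → ZMod 2) (x : Fin n) : Equiv.Perm (V H × ZMod 2) where
  toFun p := (act H p.1 (of x), p.2 + f (p.1, x))
  invFun p := (act H p.1 (of x)⁻¹, p.2 - f (act H p.1 (of x)⁻¹, x))
  left_inv p := by simp
  right_inv p := by simp

theorem cocycle_exists (f : V H × Fin n → ZMod 2) :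
    ∃ c : V H → FreeGroup (Fin n) → ZMod 2, (∀ v x, c v (of x) = f (v, x)) ∧
      ∀ v g k, c v (g * k) = c v g + c (act H v g) k := by
  let Φ : FreeGroup (Fin n) →* (Equiv.Perm (V H × ZMod 2))ᵐᵒᵖ :=
    FreeGroup.lift fun x => MulOpposite.op (gperm H f x)
  have hmul : ∀ g k p, (Φ (g * k)).unop p = (Φ k).unop ((Φ g).unop p) := by
    intro g k p; simp
  have key : ∀ g, ∃ d : V H → ZMod 2, ∀ p : V H × ZMod 2,
      (Φ g).unop p = (act H p.1 g, p.2 + d p.1) := by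
    intro g
    induction g using FreeGroup.induction_on with
    | C1 => exact ⟨fun _ => 0, by simp⟩
    | of x => exact ⟨fun v => f (v, x), fun p => by simp [Φ, gperm]⟩
    | inv_of x _ =>
      refine ⟨fun v => - f (act H v (of x)⁻¹, x), fun p => ?_⟩
      simp only [Φ, _root_.map_inv, FreeGroup.lift_apply_of, MulOpposite.unop_inv, MulOpposite.unop_op]
      rw [← sub_eq_add_neg]
      rfl
    | mul g k hg hk =>
      obtain ⟨d, hd⟩ := hg
      obtain ⟨d', hd'⟩ := hk
      refine ⟨fun v => d v + d' (act H v g), fun p => ?_⟩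
      rw [hmul, hd, hd']
      simp [add_assoc]
  choose d hd using key
  refine ⟨fun v g => d g v, fun v x => ?_, fun v g k => ?_⟩
  · have := hd (of x) (v, 0)
    simpa [Φ, gperm] using this.symm
  · have h1 := hd (g * k) (v, 0)
    rw [hmul, hd, hd] at h1
    simpa using (congrArg Prod.snd h1).symm

open scoped Classical in
/-- transversal auxiliary -/
noncomputable def taux : ℕ → V H → FreeGroup (Fin n)
  | 0, _ => 1
  | k + 1, v => if h : v ≠ v0 H then taux k (par H v h).1 * letter (par H v h).2 else 1

/-- Schreier transversal -/
noncomputable def tr (v : V H) : FreeGroup (Fin n) := taux H (cosetMinLen H v) v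

theorem tr_v0 : tr H (v0 H) = 1 := by rw [tr, len_v0]; rfl

theorem tr_par (v : V H) (h : v ≠ v0 H) :
    tr H v = tr H (par H v h).1 * letter (par H v h).2 := by
  rw [tr, ← par_len H v h, taux, dif_pos h]; rfl

theorem tree_ind {P : V H → Prop} (h0 : P (v0 H))
    (hs : ∀ v h, P (par H v h).1 → P v) (v : V H) : P v := by
  have : ∀ k v, cosetMinLen H v = k → P v := by
    intro k
    induction k with
    | zero => intro v hv; rw [(len_eq_zero H).1 hv]; exact h0
    | succ k ih =>
      intro v hv
      have h : v ≠ v0 H := by rintro rfl; rw [len_v0] at hv; omega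
      refine hs v h (ih _ ?_)
      have := par_len H v h
      omega
  exact this _ v rfl

theorem cl_tr (v : V H) : cl H (tr H v) = v := by
  induction v using tree_ind H with
  | h0 => rw [tr_v0]; rfl
  | hs v h ih => rw [tr_par H v h, ← act_cl, ih, par_act]

/-- Schreier generator -/
noncomputable def sg (e : V H × Fin n) : FreeGroup (Fin n) :=
  tr H e.1 * of e.2 * (tr H (tgt H e))⁻¹

theorem sg_mem (e : V H × Fin n) : sg H e ∈ H := by
  rw [sg, ← cl_eq, cl_tr, ← act_cl, cl_tr]; rfl

theorem sg_te (v : {v : V H // v ≠ v0 H}) : sg H (te H v) = 1 := by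
  have h := tr_par H v.1 v.2
  have ha := te_ends H v
  have hl := par_len H v.1 v.2
  unfold sg te letter at *
  split_ifs at * with hb
  · rcases ha with ha | ha
    · rw [ha.2, h]; simp
    · have := congrArg (cosetMinLen H) ha.1
      simp only at this; omega
  · rcases ha with ha | ha
    · have := congrArg (cosetMinLen H) ha.1
      simp only at this; omega
    · rw [ha.2, h]; simp

/-- a map into `ZMod 2` satisfying the cocycle rule and vanishing on tree edges
vanishes on the transversal -/
theorem c_tr {f : V H × Fin n → ZMod 2} {c : V H → FreeGroup (Fin n) → ZMod 2}
    (hf : ∀ v, f (te H v) = 0)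
    (h1 : ∀ v x, c v (of x) = f (v, x)) (h2 : ∀ v g k, c v (g * k) = c v g + c (act H v g) k)
    (v : V H) : c (v0 H) (tr H v) = 0 := by
  have h3 : ∀ v, c v 1 = 0 := by
    intro v
    have := h2 v 1 1
    simpa using this
  induction v using tree_ind H with
  | h0 => rw [tr_v0, h3]
  | hs v h ih =>
    rw [tr_par H v h, h2, ih, act_v0, cl_tr, zero_add]
    have hv := hf ⟨v, h⟩
    have hp := par_act H v h
    unfold te at hv
    unfold letter at hp ⊢
    simp only at hv
    split_ifs at * with hb
    · rw [h1, hv]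
    · have h4 := h2 (par H v h).1 (of (par H v h).2.1)⁻¹ (of (par H v h).2.1)
      rw [hp, h1, hv] at h4
      simpa [h3] using h4.symm

theorem c_sg {f : V H × Fin n → ZMod 2} {c : V H → FreeGroup (Fin n) → ZMod 2}
    (hf : ∀ v, f (te H v) = 0)
    (h1 : ∀ v x, c v (of x) = f (v, x)) (h2 : ∀ v g k, c v (g * k) = c v g + c (act H v g) k)
    (e : V H × Fin n) : c (v0 H) (sg H e) = f e := by
  have ht := c_tr H hf h1 h2
  have h := h2 (v0 H) (sg H e) (tr H (tgt H e))
  rw [act_v0, (cl_mem H).2 (sg_mem H e), ht, add_zero] at h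
  rw [← h, sg, inv_mul_cancel_right, h2, ht, act_v0, cl_tr, h1, zero_add]

/-- a homomorphism killing all Schreier generators is trivial -/
theorem hom_ext {φ ψ : H →* Multiplicative (ZMod 2)}
    (h : ∀ e, φ ⟨sg H e, sg_mem H e⟩ = ψ ⟨sg H e, sg_mem H e⟩) : φ = ψ := by
  have key : ∀ (g : FreeGroup (Fin n)) (v : V H),
      ∃ hm : tr H v * g * (tr H (act H v g))⁻¹ ∈ H,  φ ⟨_, hm⟩ = ψ ⟨_, hm⟩ := by
    intro g
    induction g using FreeGroup.induction_on with
    | C1 => 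
      intro v
      have h1 : tr H v * 1 * (tr H (act H v 1))⁻¹ = 1 := by simp
      have hm : tr H v * 1 * (tr H (act H v 1))⁻¹ ∈ H := by rw [h1]; exact H.one_mem
      refine ⟨hm, ?_⟩
      have : (⟨_, hm⟩ : H) = 1 := Subtype.ext h1
      rw [this]; simp
    | of x => exact fun v => ⟨sg_mem H (v, x), h (v, x)⟩
    | inv_of x _ =>
      intro v
      have h1 : tr H v * (of x)⁻¹ * (tr H (act H v (of x)⁻¹))⁻¹ =
          (sg H (act H v (of x)⁻¹, x))⁻¹ := by
        simp [sg, tgt, mul_assoc]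
      have hm := H.inv_mem (sg_mem H (act H v (of x)⁻¹, x))
      refine ⟨h1 ▸ hm, ?_⟩
      have : (⟨_, h1 ▸ hm⟩ : H) = (⟨_, sg_mem H (act H v (of x)⁻¹, x)⟩ : H)⁻¹ := Subtype.ext h1
      rw [this, _root_.map_inv, _root_.map_inv, h]
    | mul g k hg hk =>
      intro v
      obtain ⟨m1, e1⟩ := hg v
      obtain ⟨m2, e2⟩ := hk (act H v g)
      have h1 : tr H v * (g * k) * (tr H (act H v (g * k)))⁻¹ =
        (tr H v * g * (tr H (act H v g))⁻¹) *
          (tr H (act H v g) * k * (tr H (act H (act H v g) k))⁻¹) := by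
        simp [mul_assoc]
      have hm := H.mul_mem m1 m2
      refine ⟨h1 ▸ hm, ?_⟩
      have : (⟨_, h1 ▸ hm⟩ : H) = (⟨_, m1⟩ : H) * ⟨_, m2⟩ := Subtype.ext h1
      rw [this, _root_.map_mul, _root_.map_mul, e1, e2]
  ext g
  obtain ⟨hm, he⟩ := key g.1 (v0 H)
  have h1 : tr H (v0 H) * g.1 * (tr H (act H (v0 H) g.1))⁻¹ = g.1 := by
    rw [act_v0, (cl_mem H).2 g.2, tr_v0]; simp
  have : (⟨_, hm⟩ : H) = g := Subtype.ext h1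
  rw [this] at he
  rw [he]

theorem restrict_bij : Function.Bijective
    (fun (φ : H →* Multiplicative (ZMod 2)) (e : N H) => φ ⟨sg H e.1, sg_mem H e.1⟩) := by
  classical
  constructor
  · intro φ ψ h
    apply hom_ext
    intro e
    by_cases he : e ∈ N H
    · exact congrFun h ⟨e, he⟩
    · obtain ⟨v, rfl⟩ := not_not.1 he
      have : (⟨_, sg_mem H (te H v)⟩ : H) = 1 := Subtype.ext (sg_te H v)
      rw [this]; simp
  · intro F
    let f : V H × Fin n → ZMod 2 := fun e =>
      if he : e ∈ N H then Multiplicative.toAdd (F ⟨e, he⟩) else 0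
    have hf : ∀ v, f (te H v) = 0 := by
      intro v; simp [f, N]
    obtain ⟨c, h1, h2⟩ := cocycle_exists H f
    refine ⟨MonoidHom.mk' (fun h => Multiplicative.ofAdd (c (v0 H) h.1)) ?_, ?_⟩
    · intro a b
      rw [← ofAdd_add, Subgroup.coe_mul, h2, act_v0, (cl_mem H).2 a.2]
    · funext e
      have := c_sg H hf h1 h2 e.1
      simp only [MonoidHom.mk'_apply, this]
      simp [f]

theorem basis_equiv (B : Set (FreeGroup (Fin n))) (hB : IsFreeBasis H B) :
    Nonempty ((B → ZMod 2) ≃ (N H → ZMod 2)) := by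
  obtain ⟨hm, hb⟩ := hB
  let e1 : FreeGroup B ≃* H := MulEquiv.ofBijective _ hb
  let e2 : (B → Multiplicative (ZMod 2)) ≃ (FreeGroup B →* Multiplicative (ZMod 2)) :=
    FreeGroup.lift
  let e3 : (FreeGroup B →* Multiplicative (ZMod 2)) ≃ (H →* Multiplicative (ZMod 2)) :=
    { toFun := fun φ => φ.comp e1.symm.toMonoidHom
      invFun := fun φ => φ.comp e1.toMonoidHom
      left_inv := fun φ => by ext x; simp
      right_inv := fun φ => by ext x; simp }
  exact ⟨(e2.trans e3).trans (Equiv.ofBijective _ (restrict_bij H))⟩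

theorem fin_of_equiv {α β : Type*} (e : (α → ZMod 2) ≃ (β → ZMod 2)) [Finite α] : Finite β := by
  classical
  have : Finite (β → ZMod 2) := Finite.of_equiv _ e
  refine Finite.of_injective (fun b : β => (Pi.single b 1 : β → ZMod 2)) ?_
  intro a b h
  by_contra hab
  have := congrFun h a
  simp [Pi.single_apply, hab] at this

theorem card_of_equiv {α β : Type*} (e : (α → ZMod 2) ≃ (β → ZMod 2)) [Finite α] :
    Nat.card α = Nat.card β := by
  have := fin_of_equiv e
  have h := Nat.card_congr e
  rw [Nat.card_fun, Nat.card_fun, Nat.card_zmod] at h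
  exact Nat.pow_right_injective le_rfl h

end CG

/-- The sequence `1 + (n−1)·Γ_{F/H}(i) − γ_{F/H}(i+1)/2` is nondecreasing and
converges (in `[0,∞]`) to the rank of `H`. -/
theorem rank_eq_lim_cogrowth {n : ℕ} (hn : 1 ≤ n) (H : Subgroup (FreeGroup (Fin n)))
    (B : Set (FreeGroup (Fin n))) (hB : IsFreeBasis H B) :
    Monotone (rH n H) ∧
    Filter.Tendsto (fun i => ((rH n H i : ℝ) : EReal)) Filter.atTop
      (nhds (rankEReal B)) := by
  obtain ⟨e⟩ := CG.basis_equiv H B hB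
  refine ⟨CG.rH_mono H, ?_⟩
  unfold rankEReal
  split_ifs with h
  · have : Finite B := h
    have hN : (CG.N H).Finite := CG.fin_of_equiv e
    have hc : B.ncard = (CG.N H).ncard := CG.card_of_equiv e
    rw [← Set.ncard_eq_toFinset_card _ h, hc]
    exact CG.tendsto_fin H hN
  · refine CG.tendsto_inf H fun hN => h ?_
    have : Finite (CG.N H) := hN
    exact CG.fin_of_equiv e.symm
end

section
/- Let H be a subgroup of F. For every i ≥ 0, rk_H(2i+1) ≤ r_H(i) ≤ rk_H(2i+3), where r_H(i) = 1 + (n−1)·Γ_{F/H}(i) − γ_{F/H}(i+1)/2. -/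
open FreeGroup

/-- `rk` is the rank-growth function of `H`: `rk i` is the rank (the size of a
finite free basis) of the subgroup `H_i` generated by the elements of `H` of
length at most `i`. -/
def IsRankGrowth {n : ℕ} (H : Subgroup (FreeGroup (Fin n))) (rk : ℕ → ℕ) : Prop :=
  ∀ i, ∃ B : Set (FreeGroup (Fin n)), B.Finite ∧ B.ncard = rk i ∧
    IsFreeBasis (Subgroup.closure {h : FreeGroup (Fin n) | h ∈ H ∧ FreeGroup.norm h ≤ i}) B

namespace RG

variable {n : ℕ} (H : Subgroup (FreeGroup (Fin n)))

/-- The type of right cosets. -/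
abbrev Q := Quotient (QuotientGroup.rightRel H)

/-- The right coset of `g`. -/
def cl (g : FreeGroup (Fin n)) : Q H := Quotient.mk (QuotientGroup.rightRel H) g

theorem cl_eq {a b : FreeGroup (Fin n)} : cl H a = cl H b ↔ b * a⁻¹ ∈ H := by
  unfold cl
  rw [Quotient.eq, QuotientGroup.rightRel_apply]

theorem cl_mul_left {h : FreeGroup (Fin n)} (hh : h ∈ H) (g : FreeGroup (Fin n)) :
    cl H (h * g) = cl H g := by
  rw [cl_eq]
  simpa using hh

theorem cl_surj (q : Q H) : ∃ g, cl H g = q := Quotient.exists_rep q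

/-- Right multiplication on cosets. -/
def rm (y : FreeGroup (Fin n)) : Q H → Q H :=
  Quotient.map (fun g => g * y) (by
    intro a b hab
    have := QuotientGroup.rightRel_apply.1 hab
    refine QuotientGroup.rightRel_apply.2 ?_
    simpa [mul_assoc] using this)

theorem rm_cl (y g : FreeGroup (Fin n)) : rm H y (cl H g) = cl H (g * y) := rfl

theorem rm_rm (y z : FreeGroup (Fin n)) (q : Q H) : rm H z (rm H y q) = rm H (y * z) q := by
  obtain ⟨g, rfl⟩ := cl_surj H q
  simp [rm_cl, mul_assoc]

theorem rm_one (q : Q H) : rm H 1 q = q := by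
  obtain ⟨g, rfl⟩ := cl_surj H q
  simp [rm_cl]

theorem len_le (g : FreeGroup (Fin n)) : cosetMinLen H (cl H g) ≤ FreeGroup.norm g :=
  Nat.sInf_le ⟨g, rfl, rfl⟩

theorem exists_rep (q : Q H) : ∃ g, cl H g = q ∧ FreeGroup.norm g = cosetMinLen H q := by
  obtain ⟨g, hg⟩ := cl_surj H q
  have : (FreeGroup.norm '' {g | Quotient.mk (QuotientGroup.rightRel H) g = q}).Nonempty :=
    ⟨_, g, hg, rfl⟩
  obtain ⟨a, ha, hb⟩ := Nat.sInf_mem this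
  exact ⟨a, ha, hb⟩

/-- Shortest representatives. -/
noncomputable def rep (q : Q H) : FreeGroup (Fin n) := (exists_rep H q).choose

theorem cl_rep (q : Q H) : cl H (rep H q) = q := (exists_rep H q).choose_spec.1
theorem norm_rep (q : Q H) : FreeGroup.norm (rep H q) = cosetMinLen H q :=
  (exists_rep H q).choose_spec.2

theorem len_one : cosetMinLen H (cl H 1) = 0 := by
  have := len_le H 1
  simpa using this

theorem rep_one : rep H (cl H 1) = 1 := by
  have := norm_rep H (cl H 1)
  rw [len_one] at this
  exact FreeGroup.norm_eq_zero.1 this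

theorem finite_ball (r : ℕ) : Finite {q : Q H // cosetMinLen H q ≤ r} := by
  have h1 : {g : FreeGroup (Fin n) | FreeGroup.norm g ≤ r}.Finite := by
    have := (List.finite_length_le (Fin n × Bool) r)
    refine Set.Finite.of_finite_image (f := FreeGroup.toWord) (this.subset ?_)
      (FreeGroup.toWord_injective.injOn)
    rintro _ ⟨g, hg, rfl⟩
    exact hg
  have h2 : {q : Q H | cosetMinLen H q ≤ r}.Finite := by
    refine (h1.image (cl H)).subset ?_
    intro q hq
    exact ⟨rep H q, by simpa [norm_rep] using hq, cl_rep H q⟩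
  exact h2.to_subtype

theorem norm_of_inv (x : Fin n) : FreeGroup.norm (FreeGroup.of x)⁻¹ = 1 := by simp

theorem len_rm_le (x : Fin n) (q : Q H) :
    cosetMinLen H (rm H (FreeGroup.of x) q) ≤ cosetMinLen H q + 1 := by
  have h1 := len_le H (rep H q * FreeGroup.of x)
  rw [← rm_cl, cl_rep] at h1
  have h2 := FreeGroup.norm_mul_le (rep H q) (FreeGroup.of x)
  rw [norm_rep, FreeGroup.norm_of] at h2
  omega

theorem len_le_rm (x : Fin n) (q : Q H) :
    cosetMinLen H q ≤ cosetMinLen H (rm H (FreeGroup.of x) q) + 1 := by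
  have h1 := len_le H (rep H (rm H (FreeGroup.of x) q) * (FreeGroup.of x)⁻¹)
  rw [← rm_cl, cl_rep, rm_rm, mul_inv_cancel, rm_one] at h1
  have h2 := FreeGroup.norm_mul_le (rep H (rm H (FreeGroup.of x) q)) (FreeGroup.of x)⁻¹
  rw [norm_rep, norm_of_inv] at h2
  omega

/-- A nontrivial coset has a neighbour one step closer to the base point. -/
theorem exists_pred (q : Q H) (i : ℕ) (hq : cosetMinLen H q = i + 1) :
    ∃ x : Fin n, ∃ p : Q H, cosetMinLen H p ≤ i ∧
      (rm H (FreeGroup.of x) p = q ∨ rm H (FreeGroup.of x) q = p) := by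
  have hn := norm_rep H q
  rw [hq] at hn
  obtain ⟨L, a, hL⟩ : ∃ L a, (rep H q).toWord = L ++ [a] := by
    rcases List.eq_nil_or_concat (rep H q).toWord with h | ⟨L, a, h⟩
    · simp [FreeGroup.norm, h] at hn
    · exact ⟨L, a, by simpa using h⟩
  have hrep : rep H q = FreeGroup.mk L * FreeGroup.mk [a] := by
    rw [FreeGroup.mul_mk, ← hL, FreeGroup.mk_toWord]
  have hlen : L.length = i := by
    simp [FreeGroup.norm, hL] at hn
    exact hn
  have hp : cosetMinLen H (cl H (FreeGroup.mk L)) ≤ i :=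
    (len_le H _).trans (FreeGroup.norm_mk_le.trans hlen.le)
  obtain ⟨x, b⟩ := a
  refine ⟨x, cl H (FreeGroup.mk L), hp, ?_⟩
  cases b
  · right
    have : FreeGroup.mk [(x, false)] = (FreeGroup.of x)⁻¹ := by
      simp [FreeGroup.of, FreeGroup.inv_mk, FreeGroup.invRev]
    rw [this] at hrep
    rw [← cl_rep H q, rm_cl, hrep]
    simp
  · left
    rw [rm_cl, ← cl_rep H q, hrep]
    rfl

/-- Path lemma, list version. -/
theorem path_list (r : ℕ) (D : FreeGroup (Fin n) → Prop) (h1 : D 1)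
    (hD : ∀ g x, cosetMinLen H (cl H g) ≤ r → cosetMinLen H (cl H (g * FreeGroup.of x)) ≤ r →
      (D g ↔ D (g * FreeGroup.of x)))
    (L : List (Fin n × Bool))
    (hL : ∀ L₁, L₁ <+: L → cosetMinLen H (cl H (FreeGroup.mk L₁)) ≤ r) :
    D (FreeGroup.mk L) := by
  induction L using List.reverseRecOn with
  | nil => exact h1
  | append_singleton L a ih =>
    have h2 := ih (fun L₁ h => hL L₁ (h.trans (List.prefix_append _ _)))
    have h3 := hL L (List.prefix_append _ _)
    have h4 := hL _ (List.prefix_refl _)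
    rw [← FreeGroup.mul_mk] at h4 ⊢
    obtain ⟨x, b⟩ := a
    cases b
    · have : FreeGroup.mk [(x, false)] = (FreeGroup.of x)⁻¹ := by
        simp [FreeGroup.of, FreeGroup.inv_mk, FreeGroup.invRev]
      rw [this] at h4 ⊢
      refine (hD _ x h4 ?_).2 ?_
      · simpa using h3
      · simpa using h2
    · exact (hD _ x h3 h4).1 h2

theorem path_ball (r : ℕ) (D : FreeGroup (Fin n) → Prop) (h1 : D 1)
    (hD : ∀ g x, cosetMinLen H (cl H g) ≤ r → cosetMinLen H (cl H (g * FreeGroup.of x)) ≤ r →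
      (D g ↔ D (g * FreeGroup.of x))) (g : FreeGroup (Fin n)) (hg : FreeGroup.norm g ≤ r) :
    D g := by
  rw [← FreeGroup.mk_toWord (x := g)]
  refine path_list H r D h1 hD _ ?_
  intro L₁ h
  have := h.length_le
  exact (len_le H _).trans (FreeGroup.norm_mk_le.trans (this.trans hg))

theorem path_loop (r : ℕ) (D : FreeGroup (Fin n) → Prop) (h1 : D 1)
    (hD : ∀ g x, cosetMinLen H (cl H g) ≤ r → cosetMinLen H (cl H (g * FreeGroup.of x)) ≤ r →
      (D g ↔ D (g * FreeGroup.of x))) (h : FreeGroup (Fin n)) (hH : h ∈ H)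
    (hg : FreeGroup.norm h ≤ 2 * r + 1) :
    D h := by
  rw [← FreeGroup.mk_toWord (x := h)]
  refine path_list H r D h1 hD _ ?_
  rintro L₁ ⟨L₂, hL⟩
  have hlen : L₁.length + L₂.length ≤ 2 * r + 1 := by
    rw [← List.length_append, hL]; exact hg
  by_cases hc : L₁.length ≤ r
  · exact (len_le H _).trans (FreeGroup.norm_mk_le.trans hc)
  · have e : h = FreeGroup.mk L₁ * FreeGroup.mk L₂ := by
      rw [FreeGroup.mul_mk, hL, FreeGroup.mk_toWord]
    have e2 : FreeGroup.mk L₁ = h * (FreeGroup.mk L₂)⁻¹ := by rw [e, mul_inv_cancel_right]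
    rw [e2, cl_mul_left H hH]
    refine (len_le H _).trans ?_
    rw [FreeGroup.norm_inv_eq]
    refine FreeGroup.norm_mk_le.trans ?_
    omega

/-- A function invariant under right multiplication by generators is constant. -/
theorem const_of {α : Type*} (f : FreeGroup (Fin n) → α)
    (hf : ∀ g x, f (g * FreeGroup.of x) = f g) (g : FreeGroup (Fin n)) : f g = f 1 := by
  have key : ∀ h g : FreeGroup (Fin n), f (g * h) = f g := by
    intro h
    induction h using FreeGroup.induction_on with
    | C1 => simp
    | of x => exact fun g => hf g x
    | inv_of x _ =>
      intro g
      have := hf (g * (FreeGroup.of x)⁻¹) x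
      simpa using this.symm
    | mul a b ha hb =>
      intro g
      rw [← mul_assoc, hb, ha]
  simpa using key g 1

/-- The step permutation used to integrate a cochain. -/
def stepPerm (c : FreeGroup (Fin n) → Fin n → ℚ) (x : Fin n) :
    Equiv.Perm (FreeGroup (Fin n) × ℚ) where
  toFun p := (p.1 * FreeGroup.of x, p.2 + c p.1 x)
  invFun p := (p.1 * (FreeGroup.of x)⁻¹, p.2 - c (p.1 * (FreeGroup.of x)⁻¹) x)
  left_inv p := by simp
  right_inv p := by simp

/-- Integration of a cochain. -/
def act (c : FreeGroup (Fin n) → Fin n → ℚ) :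
    FreeGroup (Fin n) →* (Equiv.Perm (FreeGroup (Fin n) × ℚ))ᵐᵒᵖ :=
  FreeGroup.lift (fun x => MulOpposite.op (stepPerm c x))

/-- The potential. -/
def pot (c : FreeGroup (Fin n) → Fin n → ℚ) (g : FreeGroup (Fin n)) : ℚ :=
  ((act c g).unop (1, 0)).2

theorem act_step (c : FreeGroup (Fin n) → Fin n → ℚ) (g : FreeGroup (Fin n)) (x : Fin n)
    (p : FreeGroup (Fin n) × ℚ) :
    (act c (g * FreeGroup.of x)).unop p = stepPerm c x ((act c g).unop p) := by
  simp [act]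

theorem act_fst (c : FreeGroup (Fin n) → Fin n → ℚ) (g : FreeGroup (Fin n)) :
    ((act c g).unop (1, 0)).1 = g := by
  have := const_of (fun g => ((act c g).unop (1, 0)).1 * g⁻¹) (by
    intro g x
    simp only [act_step]
    simp [stepPerm]) g
  simpa [mul_inv_eq_one] using this

theorem pot_one (c : FreeGroup (Fin n) → Fin n → ℚ) : pot c 1 = 0 := by simp [pot]

theorem pot_step (c : FreeGroup (Fin n) → Fin n → ℚ) (g : FreeGroup (Fin n)) (x : Fin n) :
    pot c (g * FreeGroup.of x) = pot c g + c g x := by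
  unfold pot
  rw [act_step]
  simp only [stepPerm, Equiv.coe_fn_mk]
  rw [act_fst]

theorem pot_unique (c : FreeGroup (Fin n) → Fin n → ℚ) (P : FreeGroup (Fin n) → ℚ)
    (h1 : P 1 = 0) (hP : ∀ g x, P (g * FreeGroup.of x) = P g + c g x) (g : FreeGroup (Fin n)) :
    P g = pot c g := by
  have := const_of (fun g => P g - pot c g) (by
    intro g x
    simp only [hP, pot_step]; ring) g
  simp only [h1, pot_one] at this
  linarith

theorem pot_add (c d : FreeGroup (Fin n) → Fin n → ℚ) (g : FreeGroup (Fin n)) :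
    pot (fun a x => c a x + d a x) g = pot c g + pot d g := by
  symm
  apply pot_unique _ (fun g => pot c g + pot d g)
  · simp [pot_one]
  · intro g x
    simp only [pot_step]; ring

theorem pot_smul (t : ℚ) (c : FreeGroup (Fin n) → Fin n → ℚ) (g : FreeGroup (Fin n)) :
    pot (fun a x => t * c a x) g = t * pot c g := by
  symm
  apply pot_unique _ (fun g => t * pot c g)
  · simp [pot_one]
  · intro g x
    simp only [pot_step]; ring

theorem pot_mul (c : FreeGroup (Fin n) → Fin n → ℚ) (h : FreeGroup (Fin n))
    (hc : ∀ g x, c (h * g) x = c g x) (g : FreeGroup (Fin n)) :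
    pot c (h * g) = pot c h + pot c g := by
  have := pot_unique c (fun g => pot c (h * g) - pot c h) (by simp) (by
    intro g x
    simp only [← mul_assoc, pot_step, hc]; ring) g
  linarith

/-- The subgroup generated by short elements. -/
def K (j : ℕ) : Subgroup (FreeGroup (Fin n)) :=
  Subgroup.closure {h : FreeGroup (Fin n) | h ∈ H ∧ FreeGroup.norm h ≤ j}

theorem K_le (j : ℕ) : K H j ≤ H := by
  rw [K, Subgroup.closure_le]
  exact fun h hh => hh.1

/-- Vertices of the ball. -/
abbrev V (r : ℕ) := {q : Q H // cosetMinLen H q ≤ r}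

/-- Edges of the ball. -/
abbrev E (r : ℕ) := {e : Q H × Fin n // cosetMinLen H e.1 ≤ r ∧
  cosetMinLen H (rm H (FreeGroup.of e.2) e.1) ≤ r}

open Classical in
/-- Extension by zero of an edge cochain. -/
noncomputable def ext (r : ℕ) (c : E H r → ℚ) (g : FreeGroup (Fin n)) (x : Fin n) : ℚ :=
  if h : cosetMinLen H (cl H g) ≤ r ∧ cosetMinLen H (rm H (FreeGroup.of x) (cl H g)) ≤ r
  then c ⟨(cl H g, x), h⟩ else 0

theorem ext_inv (r : ℕ) (c : E H r → ℚ) (h : FreeGroup (Fin n)) (hh : h ∈ H)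
    (g : FreeGroup (Fin n)) (x : Fin n) : ext H r c (h * g) x = ext H r c g x := by
  unfold ext
  simp only [cl_mul_left H hh]

/-- Restriction of the potential to a set. -/
noncomputable def Psi (r : ℕ) (B : Set (FreeGroup (Fin n))) : (E H r → ℚ) →ₗ[ℚ] (B → ℚ) where
  toFun c b := pot (ext H r c) b
  map_add' c d := by
    funext b
    rw [Pi.add_apply, ← pot_add]
    congr 1
    funext g x
    unfold ext
    split_ifs <;> simp
  map_smul' t c := by
    funext b
    rw [Pi.smul_apply, smul_eq_mul, RingHom.id_apply, ← pot_smul]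
    congr 1
    funext g x
    unfold ext
    split_ifs <;> simp

/-- Coboundary. -/
def delta (r : ℕ) : (V H r → ℚ) →ₗ[ℚ] (E H r → ℚ) where
  toFun f e := f ⟨_, e.2.2⟩ - f ⟨_, e.2.1⟩
  map_add' f g := by
    funext e
    simp only [Pi.add_apply]; ring
  map_smul' t f := by
    funext e
    simp only [Pi.smul_apply, smul_eq_mul, RingHom.id_apply]; ring

theorem short_mem (r : ℕ) (q : Q H) (x : Fin n) (h1 : cosetMinLen H q ≤ r)
    (h2 : cosetMinLen H (rm H (FreeGroup.of x) q) ≤ r) :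
    rep H q * FreeGroup.of x * (rep H (rm H (FreeGroup.of x) q))⁻¹ ∈ K H (2 * r + 1) := by
  refine Subgroup.subset_closure ⟨?_, ?_⟩
  · rw [← cl_eq, cl_rep, ← rm_cl, cl_rep]
  · have a := FreeGroup.norm_mul_le (rep H q * FreeGroup.of x)
      (rep H (rm H (FreeGroup.of x) q))⁻¹
    have b := FreeGroup.norm_mul_le (rep H q) (FreeGroup.of x)
    rw [FreeGroup.norm_inv_eq, norm_rep] at a
    rw [FreeGroup.norm_of, norm_rep] at b
    omega

open Classical in
/-- Extension by zero of a vertex function. -/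
noncomputable def vext (r : ℕ) (f : V H r → ℚ) (q : Q H) : ℚ :=
  if h : cosetMinLen H q ≤ r then f ⟨q, h⟩ else 0

theorem vext_of (r : ℕ) (f : V H r → ℚ) (q : Q H) (h : cosetMinLen H q ≤ r) :
    vext H r f q = f ⟨q, h⟩ := by simp [vext, h]

theorem ker_delta (r : ℕ) (f : V H r → ℚ) (hf : delta H r f = 0) (q : V H r) :
    f q = f ⟨cl H 1, by simp [len_one]⟩ := by
  have := path_ball H r (fun g => vext H r f (cl H g) = vext H r f (cl H 1)) rfl (by
    intro g x h1 h2
    rw [← rm_cl] at h2 ⊢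
    have := congrFun hf ⟨(cl H g, x), h1, h2⟩
    simp only [delta, LinearMap.coe_mk, AddHom.coe_mk, Pi.zero_apply] at this
    rw [vext_of H r f _ h1, vext_of H r f _ h2, sub_eq_zero.1 this]) (rep H q.1)
    (by rw [norm_rep]; exact q.2)
  rw [cl_rep, vext_of H r f _ q.2, vext_of H r f _ (by simp [len_one])] at this
  exact this

theorem finrank_ker_delta (r : ℕ) : Module.finrank ℚ (LinearMap.ker (delta H r)) = 1 := by
  have h1 : (fun _ => 1 : V H r → ℚ) ∈ LinearMap.ker (delta H r) := by
    rw [LinearMap.mem_ker]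
    funext e
    simp [delta]
  refine finrank_eq_one ⟨_, h1⟩ ?_ ?_
  · intro h
    have := congrFun (congrArg Subtype.val h) ⟨cl H 1, by simp [len_one]⟩
    simp at this
  · intro w
    refine ⟨w.1 ⟨cl H 1, by simp [len_one]⟩, ?_⟩
    ext q
    simp only [SetLike.mk_smul_mk, Pi.smul_apply, smul_eq_mul, mul_one]
    exact (ker_delta H r w.1 w.2 q).symm

/-- The potential vanishes on the subgroup iff it does on a generating set. -/
theorem pot_zero_closure (r : ℕ) (c : E H r → ℚ) (S : Set (FreeGroup (Fin n)))
    (hS : ∀ b ∈ S, b ∈ H) (h0 : ∀ b ∈ S, pot (ext H r c) b = 0) (k : FreeGroup (Fin n))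
    (hk : k ∈ Subgroup.closure S) : pot (ext H r c) k = 0 := by
  have hle : Subgroup.closure S ≤ H := (Subgroup.closure_le H).2 hS
  induction hk using Subgroup.closure_induction with
  | mem x hx => exact h0 x hx
  | one => exact pot_one _
  | mul x y hx hy ihx ihy =>
    rw [pot_mul _ _ (fun g y => ext_inv H r c x (hle hx) g y), ihx, ihy, add_zero]
  | inv x hx ih =>
    have := pot_mul _ _ (fun g y => ext_inv H r c x (hle hx) g y) x⁻¹
    rw [mul_inv_cancel, pot_one, ih] at this
    linarith

theorem basis_closure {G : Type*} [Group G] (L : Subgroup G) (B : Set G) (hB : IsFreeBasis L B) :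
    Subgroup.closure B = L := by
  obtain ⟨hB, hb⟩ := hB
  apply le_antisymm
  · rw [Subgroup.closure_le]; exact hB
  · intro k hk
    obtain ⟨w, hw⟩ := hb.2 ⟨k, hk⟩
    have : k = (FreeGroup.lift (fun b : B => (⟨(b : G), hB b b.2⟩ : L)) w : L) := by rw [hw]
    rw [this]
    clear hw this
    induction w using FreeGroup.induction_on with
    | C1 => simp
    | of x => simpa using Subgroup.subset_closure x.2
    | inv_of x _ => simpa using Subgroup.subset_closure x.2
    | mul a b ha hb =>
      rw [_root_.map_mul]
      exact mul_mem ha hb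

theorem range_delta (r : ℕ) (B : Set (FreeGroup (Fin n))) (hB : IsFreeBasis (K H (2 * r + 1)) B) :
    LinearMap.range (delta H r) = LinearMap.ker (Psi H r B) := by
  have hcl := basis_closure _ _ hB
  have hBH : ∀ b ∈ B, b ∈ H := fun b hb => K_le H _ (hB.1 b hb)
  apply le_antisymm
  · rintro _ ⟨f, rfl⟩
    rw [LinearMap.mem_ker]
    funext b
    change pot (ext H r (delta H r f)) b = 0
    refine pot_zero_closure H r _ {h : FreeGroup (Fin n) | h ∈ H ∧ FreeGroup.norm h ≤ 2 * r + 1}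
      (fun h hh => hh.1) ?_ b (hB.1 b b.2)
    rintro h ⟨hh, hn⟩
    have := path_loop H r (fun g => pot (ext H r (delta H r f)) g
        = vext H r f (cl H g) - vext H r f (cl H 1)) (by simp [pot_one]) (by
      intro g x h1 h2
      rw [pot_step]
      rw [← rm_cl] at h2 ⊢
      rw [vext_of H r f _ h1, vext_of H r f _ h2]
      have : ext H r (delta H r f) g x = f ⟨_, h2⟩ - f ⟨_, h1⟩ := by
        unfold ext
        rw [dif_pos ⟨h1, h2⟩]
        rfl
      rw [this]
      constructor <;> intro h <;> linarith) h hh hn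
    rw [this, sub_eq_zero]
    congr 1
    simpa using cl_mul_left H hh 1
  · intro c hc
    rw [LinearMap.mem_ker] at hc
    have hv : ∀ k ∈ K H (2 * r + 1), pot (ext H r c) k = 0 := by
      intro k hk
      rw [← hcl] at hk
      exact pot_zero_closure H r c B hBH (fun b hb => congrFun hc ⟨b, hb⟩) k hk
    refine ⟨fun q => pot (ext H r c) (rep H q.1), ?_⟩
    funext ⟨⟨q, x⟩, h1, h2⟩
    have hk := short_mem H r q x h1 h2
    have e1 := pot_step (ext H r c) (rep H q) x
    have e2 := pot_mul (ext H r c) _ (fun g y => ext_inv H r c _ (K_le H _ hk) g y)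
      (rep H (rm H (FreeGroup.of x) q))
    rw [hv _ hk, inv_mul_cancel_right] at e2
    have e3 : ext H r c (rep H q) x = c ⟨⟨q, x⟩, h1, h2⟩ := by
      unfold ext
      simp only [cl_rep]
      rw [dif_pos ⟨h1, h2⟩]
    change pot (ext H r c) (rep H (rm H (FreeGroup.of x) q)) - pot (ext H r c) (rep H q) = _
    linarith

theorem psi_surj (r : ℕ) (B : Set (FreeGroup (Fin n))) (hB : IsFreeBasis (K H (2 * r + 1)) B) :
    Function.Surjective (Psi H r B) := by
  intro β
  obtain ⟨φ, hφm, hφB⟩ : ∃ φ : FreeGroup (Fin n) → ℚ,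
      (∀ a ∈ K H (2 * r + 1), ∀ b ∈ K H (2 * r + 1), φ (a * b) = φ a + φ b) ∧
      ∀ b : B, φ b = β b := by
    classical
    obtain ⟨hBK, hbij⟩ := hB
    let e := MulEquiv.ofBijective _ hbij
    let ψ : K H (2 * r + 1) →* Multiplicative ℚ :=
      (FreeGroup.lift (fun b : B => Multiplicative.ofAdd (β b))).comp e.symm.toMonoidHom
    refine ⟨fun g => if h : g ∈ K H (2 * r + 1) then (ψ ⟨g, h⟩).toAdd else 0, ?_, ?_⟩
    · intro a ha b hb
      simp only [ha, hb, mul_mem ha hb, dif_pos]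
      rw [← toAdd_mul, ← _root_.map_mul]
      rfl
    · intro b
      simp only [hBK b b.2, dif_pos]
      have : e.symm ⟨b, hBK b b.2⟩ = FreeGroup.of b := by
        rw [MulEquiv.symm_apply_eq]
        simp [e]
      simp [ψ, this]
  let c : E H r → ℚ := fun e => φ (rep H e.1.1 * FreeGroup.of e.1.2 *
    (rep H (rm H (FreeGroup.of e.1.2) e.1.1))⁻¹)
  have hφ1 : φ 1 = 0 := by
    have := hφm 1 (one_mem _) 1 (one_mem _)
    rw [mul_one] at this
    linarith
  have hgen : ∀ h ∈ {h : FreeGroup (Fin n) | h ∈ H ∧ FreeGroup.norm h ≤ 2 * r + 1},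
      pot (ext H r c) h = φ h := by
    rintro h ⟨hh, hn⟩
    have := path_loop H r (fun g => g * (rep H (cl H g))⁻¹ ∈ K H (2 * r + 1) ∧
        pot (ext H r c) g = φ (g * (rep H (cl H g))⁻¹)) (by
      simp [rep_one, one_mem, pot_one, hφ1]) (by
      intro g x h1 h2
      rw [pot_step]
      rw [← rm_cl] at h2 ⊢
      have hk := short_mem H r _ x h1 h2
      have e3 : ext H r c g x = φ (rep H (cl H g) * FreeGroup.of x *
          (rep H (rm H (FreeGroup.of x) (cl H g)))⁻¹) := by
        unfold ext
        rw [dif_pos ⟨h1, h2⟩]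
      rw [e3]
      have e4 : g * FreeGroup.of x * (rep H (rm H (FreeGroup.of x) (cl H g)))⁻¹ =
          (g * (rep H (cl H g))⁻¹) * (rep H (cl H g) * FreeGroup.of x *
          (rep H (rm H (FreeGroup.of x) (cl H g)))⁻¹) := by group
      rw [e4]
      constructor
      · rintro ⟨m, e⟩
        exact ⟨mul_mem m hk, by rw [hφm _ m _ hk, e]⟩
      · rintro ⟨m, e⟩
        have mtwo := (Subgroup.mul_mem_cancel_right _ hk).1 m
        refine ⟨mtwo, ?_⟩
        rw [hφm _ mtwo _ hk] at e
        linarith) h hh hn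
    have e : cl H h = cl H 1 := by simpa using cl_mul_left H hh 1
    rw [e, rep_one] at this
    simpa using this.2
  refine ⟨c, ?_⟩
  funext b
  rw [← hφB b]
  change pot (ext H r c) b = φ b
  have hb : (b : FreeGroup (Fin n)) ∈ K H (2 * r + 1) := hB.1 b b.2
  generalize (b : FreeGroup (Fin n)) = k at hb
  unfold K at hb
  induction hb using Subgroup.closure_induction with
  | mem x hx => exact hgen x hx
  | one => rw [pot_one, hφ1]
  | mul x y hx hy ihx ihy =>
    rw [pot_mul _ _ (fun g y => ext_inv H r c x (K_le H _ hx) g y), ihx, ihy, hφm _ hx _ hy]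
  | inv x hx ih =>
    have := pot_mul _ _ (fun g y => ext_inv H r c x (K_le H _ hx) g y) x⁻¹
    have h2 := hφm x hx x⁻¹ (inv_mem hx)
    rw [mul_inv_cancel, pot_one, ih] at this
    rw [mul_inv_cancel, hφ1] at h2
    linarith

theorem finite_E (r : ℕ) : Finite (E H r) := by
  have := finite_ball H r
  refine Finite.of_injective (β := V H r × Fin n) (fun e => (⟨e.1.1, e.2.1⟩, e.1.2)) ?_
  rintro ⟨⟨q, x⟩, h⟩ ⟨⟨qtwo, xtwo⟩, htwo⟩ he
  simp at he
  simp [he]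

/-- Euler characteristic formula. -/
theorem euler (r : ℕ) (B : Set (FreeGroup (Fin n))) (hf : B.Finite)
    (hB : IsFreeBasis (K H (2 * r + 1)) B) :
    B.ncard + Nat.card (V H r) = Nat.card (E H r) + 1 := by
  classical
  have := finite_ball H r
  have := finite_E H r
  have := hf.to_subtype
  have := Fintype.ofFinite (V H r)
  have := Fintype.ofFinite (E H r)
  have := Fintype.ofFinite B
  have h1 := LinearMap.finrank_range_add_finrank_ker (delta H r)
  have h2 := LinearMap.finrank_range_add_finrank_ker (Psi H r B)
  rw [LinearMap.range_eq_top.2 (psi_surj H r B hB), finrank_top, ← range_delta H r B hB] at h2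
  rw [finrank_ker_delta] at h1
  rw [Module.finrank_fintype_fun_eq_card] at h1
  rw [Module.finrank_fintype_fun_eq_card, Module.finrank_fintype_fun_eq_card] at h2
  rw [← Nat.card_coe_set_eq, Nat.card_eq_fintype_card, Nat.card_eq_fintype_card,
    Nat.card_eq_fintype_card]
  omega

/-- Edges starting in the ball. -/
def A (i : ℕ) : Set (Q H × Fin n) := {e | cosetMinLen H e.1 ≤ i}
/-- Edges ending in the ball. -/
def AEnd (i : ℕ) : Set (Q H × Fin n) := {e | cosetMinLen H (rm H (FreeGroup.of e.2) e.1) ≤ i}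

/-- Right multiplication by a generator as a permutation of the edge set. -/
def rmEquiv : Q H × Fin n ≃ Q H × Fin n where
  toFun e := (rm H (FreeGroup.of e.2) e.1, e.2)
  invFun e := (rm H (FreeGroup.of e.2)⁻¹ e.1, e.2)
  left_inv e := by simp [rm_rm, rm_one]
  right_inv e := by simp [rm_rm, rm_one]

theorem A_eq (i : ℕ) : A H i = {q : Q H | cosetMinLen H q ≤ i} ×ˢ (Set.univ : Set (Fin n)) := by
  ext e; simp [A]

theorem A_finite (i : ℕ) : (A H i).Finite := by
  rw [A_eq]
  have : {q : Q H | cosetMinLen H q ≤ i}.Finite := Set.finite_coe_iff.1 (finite_ball H i)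
  exact this.prod Set.finite_univ

theorem A_ncard (i : ℕ) : (A H i).ncard = cogrowth H i * n := by
  rw [A_eq, Set.ncard_prod, Set.ncard_univ, Nat.card_fin]
  rfl

theorem AEnd_eq (i : ℕ) : AEnd H i = (rmEquiv H).symm '' (A H i) := by
  rw [Equiv.image_symm_eq_preimage]
  rfl

theorem AEnd_finite (i : ℕ) : (AEnd H i).Finite := by
  rw [AEnd_eq]; exact (A_finite H i).image _

theorem AEnd_ncard (i : ℕ) : (AEnd H i).ncard = cogrowth H i * n := by
  rw [AEnd_eq, Set.ncard_image_of_injective _ (Equiv.injective _), A_ncard]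

theorem E_card (i : ℕ) : Nat.card (E H i) = (A H i ∩ AEnd H i).ncard := rfl

theorem union_le (i : ℕ) : (A H i ∪ AEnd H i).ncard ≤ Nat.card (E H (i + 1)) := by
  rw [E_card]
  refine Set.ncard_le_ncard ?_ ((A_finite H _).inter_of_left _)
  rintro ⟨q, x⟩ h
  have h1 := len_rm_le H x q
  have h2 := len_le_rm H x q
  simp only [A, AEnd, Set.mem_union, Set.mem_inter_iff, Set.mem_setOf_eq] at h ⊢
  omega

theorem sphere_le (i : ℕ) :
    cogrowthExact H (i + 1) + (A H i ∩ AEnd H i).ncard ≤ (A H i ∪ AEnd H i).ncard := by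
  have hfin : (A H i ∪ AEnd H i).Finite := (A_finite H i).union (AEnd_finite H i)
  have hsub : A H i ∩ AEnd H i ⊆ A H i ∪ AEnd H i :=
    Set.inter_subset_left.trans Set.subset_union_left
  rw [← Set.ncard_sdiff_add_ncard_of_subset hsub hfin]
  refine Nat.add_le_add_right ?_ _
  choose x p hp hx using fun q : {q : Q H // cosetMinLen H q = i + 1} => exists_pred H q.1 i q.2
  have hfintwo : ((A H i ∪ AEnd H i) \ (A H i ∩ AEnd H i)).Finite := hfin.subset Set.diff_subset
  have : Finite ↥((A H i ∪ AEnd H i) \ (A H i ∩ AEnd H i)) := hfintwo.to_subtype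
  rw [← Nat.card_coe_set_eq]
  have key : ∀ q : {q : Q H // cosetMinLen H q = i + 1},
      ∃ e : ↥((A H i ∪ AEnd H i) \ (A H i ∩ AEnd H i)),
        (q.1 = e.1.1 ∧ e.1 ∈ AEnd H i) ∨
        (q.1 = rm H (FreeGroup.of e.1.2) e.1.1 ∧ e.1 ∈ A H i) := by
    intro q
    have hq := q.2
    have hpq := hp q
    rcases hx q with h | h
    · refine ⟨⟨(p q, x q), ?_⟩, Or.inr ⟨h.symm, hpq⟩⟩
      simp only [A, AEnd, Set.mem_sdiff, Set.mem_union, Set.mem_inter_iff, Set.mem_setOf_eq, h]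
      omega
    · have htwo : cosetMinLen H (rm H (FreeGroup.of (x q)) q.1) ≤ i := by rw [h]; exact hpq
      refine ⟨⟨(q.1, x q), ?_⟩, Or.inl ⟨rfl, htwo⟩⟩
      simp only [A, AEnd, Set.mem_sdiff, Set.mem_union, Set.mem_inter_iff, Set.mem_setOf_eq]
      omega
  choose e he using key
  refine Nat.card_le_card_of_injective e ?_
  intro q qtwo hqq
  have h1 := he q
  have h2 := he qtwo
  rw [← hqq] at h2
  have hn := (e q).2.2
  apply Subtype.ext
  rcases h1 with ⟨a, b⟩ | ⟨a, b⟩ <;> rcases h2 with ⟨c, d⟩ | ⟨c, d⟩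
  · rw [a, c]
  · exact absurd ⟨d, b⟩ hn
  · exact absurd ⟨b, d⟩ hn
  · rw [a, c]

theorem cogrowth_succ (i : ℕ) : cogrowth H (i + 1) = cogrowth H i + cogrowthExact H (i + 1) := by
  have h1 : {q : Q H | cosetMinLen H q ≤ i + 1} =
      {q : Q H | cosetMinLen H q ≤ i} ∪ {q : Q H | cosetMinLen H q = i + 1} := by
    ext q
    simp only [Set.mem_union, Set.mem_setOf_eq]
    omega
  have hf : {q : Q H | cosetMinLen H q ≤ i + 1}.Finite := Set.finite_coe_iff.1 (finite_ball H _)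
  have h2 := Set.ncard_union_eq (s := {q : Q H | cosetMinLen H q ≤ i})
    (t := {q : Q H | cosetMinLen H q = i + 1}) (by
      rw [Set.disjoint_left]
      intro q a b
      simp only [Set.mem_setOf_eq] at a b
      omega) (hf.subset (by rw [h1]; exact Set.subset_union_left))
      (hf.subset (by rw [h1]; exact Set.subset_union_right))
  rw [← h1] at h2
  exact h2

theorem main (rk : ℕ → ℕ) (hrk : IsRankGrowth H rk) (i : ℕ) :
    (rk (2 * i + 1) : ℚ) ≤ rH n H i ∧ rH n H i ≤ (rk (2 * i + 3) : ℚ) := by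
  obtain ⟨B, hf, hc, hB⟩ := hrk (2 * i + 1)
  obtain ⟨Btwo, hftwo, hctwo, hBtwo⟩ := hrk (2 * i + 3)
  have e1 : rk (2 * i + 1) + cogrowth H i = Nat.card (E H i) + 1 := hc ▸ euler H i B hf hB
  have e2 : rk (2 * i + 3) + cogrowth H (i + 1) = Nat.card (E H (i + 1)) + 1 :=
    hctwo ▸ euler H (i + 1) Btwo hftwo hBtwo
  rw [cogrowth_succ] at e2
  have e3 := union_le H i
  have e4 := sphere_le H i
  have e5 := Set.ncard_union_add_ncard_inter (A H i) (AEnd H i) (A_finite H i) (AEnd_finite H i)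
  rw [A_ncard, AEnd_ncard] at e5
  rw [E_card] at e1
  unfold rH
  qify at e1 e2 e3 e4 e5
  constructor <;> linarith

end RG

/-- `rk_H(2i+1) ≤ r_H(i) ≤ rk_H(2i+3)` where
`r_H(i) = 1 + (n−1)·Γ_{F/H}(i) − γ_{F/H}(i+1)/2`. -/
theorem rankGrowth_le_rH_le {n : ℕ} (hn : 1 ≤ n)
    (H : Subgroup (FreeGroup (Fin n))) (rk : ℕ → ℕ) (hrk : IsRankGrowth H rk)
    (i : ℕ) :
    (rk (2 * i + 1) : ℚ) ≤ rH n H i ∧ rH n H i ≤ (rk (2 * i + 3) : ℚ) := by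
  exact RG.main H rk hrk i
end
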